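/- arXiv:2304.09375 — 2 statements merged into one kernel-verified Lean document; each statement's English description precedes it below -/
import Mathlib

section
/- There exist absolute constants C > 0 and K > 0 such that the following holds. Let F_q be a finite field of odd order q, let t ∈ F_q with t ≠ 0, and let E1, E2, E3, E4 ⊆ F_q^2 satisfy |E1||E2| ≥ C q^3 and |E3||E4| ≥ C q^3. Then |Rhom_t(E1,E2,E3,E4) − Par_t(E1,E2,E3,E4)/q| ≤ K q^{1/2} (|E1||E2|/q)^{1/2} (|E3||E4|/q)^{1/2}. -/
open Finset

/-- `‖x‖ = x₁² + x₂²` for `x ∈ F_q²`. -/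
def nrm {F : Type} [Field F] (x : F × F) : F := x.1 ^ 2 + x.2 ^ 2

/-- `Par_t(E₁,E₂,E₃,E₄)`: number of quadruples `(x,y,z,w) ∈ E₁×E₂×E₃×E₄` with
`x - y = z - w` and `‖x - y‖ = t`. -/
def parT {F : Type} [Field F] [DecidableEq F] (t : F)
    (E1 E2 E3 E4 : Finset (F × F)) : ℕ :=
  (((E1 ×ˢ E2) ×ˢ E3 ×ˢ E4).filter
    (fun p => p.1.1 - p.1.2 = p.2.1 - p.2.2 ∧ nrm (p.1.1 - p.1.2) = t)).card

/-- `Rhom_t(E₁,E₂,E₃,E₄)`: number of quadruples `(x,y,z,w) ∈ E₁×E₂×E₃×E₄` with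
`x - y = z - w`, `‖x - y‖ = t` and `‖x - z‖ = t`. -/
def rhomT {F : Type} [Field F] [DecidableEq F] (t : F)
    (E1 E2 E3 E4 : Finset (F × F)) : ℕ :=
  (((E1 ×ˢ E2) ×ˢ E3 ×ˢ E4).filter
    (fun p => p.1.1 - p.1.2 = p.2.1 - p.2.2 ∧ nrm (p.1.1 - p.1.2) = t ∧
      nrm (p.1.1 - p.2.1) = t)).card

section PartP1
open Finset Polynomial

section LFun
set_option linter.unusedSectionVars false
variable {F : Type} [Field F] [Fintype F] [DecidableEq F]

lemma mon_finite (d : ℕ) : {f : F[X] | f.Monic ∧ f.natDegree = d}.Finite := by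
  have h : Finite (degreeLT F (d+1)) := Finite.of_equiv _ (degreeLTEquiv F (d+1)).symm.toEquiv
  refine Set.Finite.subset (Set.toFinite (degreeLT F (d+1) : Set F[X])) ?_
  rintro f ⟨_, hd⟩
  simp only [SetLike.mem_coe, mem_degreeLT]
  refine (degree_le_natDegree).trans_lt ?_
  rw [hd]; exact_mod_cast Nat.lt_succ_self d

noncomputable def Mon (F : Type) [Field F] [Fintype F] [DecidableEq F] (d : ℕ) : Finset F[X] :=
  (mon_finite (F := F) d).toFinset

lemma mem_Mon {d : ℕ} {f : F[X]} : f ∈ Mon F d ↔ f.Monic ∧ f.natDegree = d := by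
  simp [Mon]

open Classical in
noncomputable def Irr (F : Type) [Field F] [Fintype F] [DecidableEq F] (d : ℕ) : Finset F[X] :=
  (Mon F d).filter Irreducible

lemma mem_Irr {d : ℕ} {f : F[X]} : f ∈ Irr F d ↔ (f.Monic ∧ f.natDegree = d) ∧ Irreducible f := by
  simp [Irr, mem_Mon]

open Classical in
lemma degree_count (d : ℕ) {h : F[X]} (hh : h ∈ Mon F d) :
    (d : ℂ) = ∑ m ∈ Icc 1 d, ∑ P ∈ Irr F m, ∑ j ∈ Icc 1 d, if P ^ j ∣ h then (m : ℂ) else 0 := by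
  obtain ⟨hm, hd⟩ := mem_Mon.1 hh
  have h0 : h ≠ 0 := hm.ne_zero
  have key : d = ∑ P ∈ (UniqueFactorizationMonoid.normalizedFactors h).toFinset,
      (UniqueFactorizationMonoid.normalizedFactors h).count P * P.natDegree := by
    have h1 := UniqueFactorizationMonoid.prod_normalizedFactors_eq h0
    rw [hm.normalize_eq_self] at h1
    have h2 : h.natDegree = ((UniqueFactorizationMonoid.normalizedFactors h).map natDegree).sum := by
      conv_lhs => rw [← h1]
      apply natDegree_multiset_prod
      exact UniqueFactorizationMonoid.zero_notMem_normalizedFactors h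
    rw [← hd, h2, Finset.sum_multiset_map_count]
    simp
  have hinner : ∀ m ∈ Icc 1 d, ∀ P ∈ Irr F m, (∑ j ∈ Icc 1 d, if P ^ j ∣ h then (m : ℂ) else 0)
      = ((UniqueFactorizationMonoid.normalizedFactors h).count P * P.natDegree : ℕ) := by
    intro m hm1 P hP
    obtain ⟨⟨hPm, hPd⟩, hPi⟩ := mem_Irr.1 hP
    have hdv : ∀ j, P ^ j ∣ h ↔ j ≤ (UniqueFactorizationMonoid.normalizedFactors h).count P := by
      intro j
      rw [UniqueFactorizationMonoid.dvd_iff_normalizedFactors_le_normalizedFactors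
        (pow_ne_zero _ hPi.ne_zero) h0, UniqueFactorizationMonoid.normalizedFactors_pow,
        UniqueFactorizationMonoid.normalizedFactors_irreducible hPi, hPm.normalize_eq_self,
        Multiset.nsmul_singleton, Multiset.le_count_iff_replicate_le]
    have hle : (UniqueFactorizationMonoid.normalizedFactors h).count P ≤ d := by
      have := natDegree_le_of_dvd ((hdv _).2 le_rfl) h0
      rw [natDegree_pow, hPd, hd] at this
      have h1 := (mem_Icc.1 hm1).1
      nlinarith
    rw [← Finset.sum_filter, Finset.sum_const]
    have : (Icc 1 d).filter (fun j => P ^ j ∣ h)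
        = Icc 1 ((UniqueFactorizationMonoid.normalizedFactors h).count P) := by
      ext j; simp only [mem_filter, mem_Icc, hdv]; omega
    rw [this, hPd]; simp
  rw [Finset.sum_congr rfl (fun m hm => Finset.sum_congr rfl (hinner m hm))]
  conv_lhs => rw [key]
  rw [← Finset.sum_biUnion (s := Icc 1 d) (t := fun m => Irr F m)]
  · rw [← Nat.cast_sum]
    congr 1
    apply Finset.sum_subset
    · intro P hP
      rw [Multiset.mem_toFinset] at hP
      have hPi := UniqueFactorizationMonoid.irreducible_of_normalized_factor P hP
      have hPn := UniqueFactorizationMonoid.normalize_normalized_factor P hP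
      have hPm : P.Monic := by rw [← hPn]; exact monic_normalize hPi.ne_zero
      rw [mem_biUnion]
      refine ⟨P.natDegree, ?_, mem_Irr.2 ⟨⟨hPm, rfl⟩, hPi⟩⟩
      rw [mem_Icc]
      refine ⟨hPi.natDegree_pos, ?_⟩
      rw [← hd]
      exact natDegree_le_of_dvd (UniqueFactorizationMonoid.dvd_of_mem_normalizedFactors hP) h0
    · intro P _ hP
      rw [Multiset.mem_toFinset] at hP
      rw [Multiset.count_eq_zero_of_notMem hP, zero_mul]
  · intro m _ m' _ hne
    rw [Function.onFun, Finset.disjoint_left]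
    intro P hP hP'
    exact hne ((mem_Irr.1 hP).1.2.symm.trans (mem_Irr.1 hP').1.2)

open Classical in
lemma sum_dvd (χ : F[X] → ℂ) (hmul : ∀ f g : F[X], f.Monic → g.Monic → χ (f * g) = χ f * χ g)
    (d : ℕ) {Q : F[X]} (hQ : Q.Monic) :
    (∑ h ∈ Mon F d, if Q ∣ h then χ h else 0) =
      if Q.natDegree ≤ d then χ Q * ∑ h ∈ Mon F (d - Q.natDegree), χ h else 0 := by
  split_ifs with hle
  · rw [← Finset.sum_filter, Finset.mul_sum]
    symm
    refine Finset.sum_bij (fun h _ => Q * h) ?_ ?_ ?_ ?_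
    · intro h hh
      obtain ⟨h1, h2⟩ := mem_Mon.1 hh
      rw [mem_filter, mem_Mon]
      refine ⟨⟨hQ.mul h1, ?_⟩, dvd_mul_right _ _⟩
      rw [hQ.natDegree_mul h1, h2]; omega
    · intro a _ b _ hab
      exact mul_left_cancel₀ hQ.ne_zero hab
    · intro h hh
      rw [mem_filter, mem_Mon] at hh
      obtain ⟨⟨h1, h2⟩, g, rfl⟩ := hh
      have hg := hQ.of_mul_monic_left h1
      refine ⟨g, ?_, rfl⟩
      rw [mem_Mon]
      refine ⟨hg, ?_⟩
      rw [hQ.natDegree_mul hg] at h2; omega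
    · intro h hh
      rw [hmul _ _ hQ (mem_Mon.1 hh).1]
  · apply Finset.sum_eq_zero
    intro h hh
    obtain ⟨h1, h2⟩ := mem_Mon.1 hh
    rw [if_neg]
    intro hd
    exact hle (h2 ▸ natDegree_le_of_dvd hd h1.ne_zero)

/-- prime power sums -/
noncomputable def SS (χ : F[X] → ℂ) (k : ℕ) : ℂ :=
  ∑ m ∈ k.divisors, ∑ P ∈ Irr F m, (m : ℂ) * χ P ^ (k / m)

lemma log_deriv (χ : F[X] → ℂ) (h1 : χ 1 = 1)
    (hmul : ∀ f g : F[X], f.Monic → g.Monic → χ (f * g) = χ f * χ g) (d : ℕ) :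
    (d : ℂ) * ∑ h ∈ Mon F d, χ h = ∑ k ∈ Icc 1 d, SS χ k * ∑ h ∈ Mon F (d - k), χ h := by
  classical
  have hpow : ∀ (P : F[X]), P.Monic → ∀ j, χ (P ^ j) = χ P ^ j := by
    intro P hP j
    induction j with
    | zero => simp [h1]
    | succ j ih => rw [pow_succ, hmul _ _ (hP.pow j) hP, ih, pow_succ]
  have e1 : (d : ℂ) * ∑ h ∈ Mon F d, χ h = ∑ m ∈ Icc 1 d, ∑ P ∈ Irr F m, ∑ j ∈ Icc 1 d,
      if m * j ≤ d then (m : ℂ) * χ P ^ j * ∑ h ∈ Mon F (d - m * j), χ h else 0 := by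
    rw [Finset.mul_sum]
    have : ∀ h ∈ Mon F d, (d : ℂ) * χ h = ∑ m ∈ Icc 1 d, ∑ P ∈ Irr F m, ∑ j ∈ Icc 1 d,
        (m : ℂ) * (if P ^ j ∣ h then χ h else 0) := by
      intro h hh
      conv_lhs => rw [degree_count d hh]
      simp only [Finset.sum_mul]
      refine sum_congr rfl fun m _ => sum_congr rfl fun P _ => sum_congr rfl fun j _ => ?_
      split_ifs <;> simp
    rw [Finset.sum_congr rfl this, Finset.sum_comm]
    refine sum_congr rfl fun m _ => ?_
    rw [Finset.sum_comm]
    refine sum_congr rfl fun P hP => ?_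
    rw [Finset.sum_comm]
    refine sum_congr rfl fun j _ => ?_
    obtain ⟨⟨hPm, hPd⟩, hPi⟩ := mem_Irr.1 hP
    rw [← Finset.mul_sum, sum_dvd χ hmul d (hPm.pow j), natDegree_pow, hPd, hpow P hPm,
      mul_comm j m]
    split_ifs <;> ring
  have e2 : ∀ k ∈ Icc 1 d, SS χ k * ∑ h ∈ Mon F (d - k), χ h =
      ∑ m ∈ Icc 1 d, ∑ P ∈ Irr F m, ∑ j ∈ Icc 1 d,
      if m * j = k then (m : ℂ) * χ P ^ j * ∑ h ∈ Mon F (d - m * j), χ h else 0 := by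
    intro k hk
    obtain ⟨hk1, hk2⟩ := mem_Icc.1 hk
    rw [SS, Finset.sum_mul]
    have hsub : k.divisors ⊆ Icc 1 d := by
      intro m hm
      have := Nat.pos_of_mem_divisors hm
      have := Nat.divisor_le hm
      rw [mem_Icc]; omega
    rw [← Finset.sum_subset hsub]
    · refine sum_congr rfl fun m hm => ?_
      rw [Finset.sum_mul]
      refine sum_congr rfl fun P _ => ?_
      have hmk := (Nat.mem_divisors.1 hm).1
      have hm0 := Nat.pos_of_mem_divisors hm
      have hmul' := Nat.mul_div_cancel' hmk
      rw [Finset.sum_eq_single (k / m)]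
      · rw [if_pos hmul', hmul']
      · intro j _ hj
        rw [if_neg]
        rintro rfl
        exact hj (by rw [Nat.mul_div_cancel_left _ hm0])
      · intro hj
        exfalso; apply hj
        rw [mem_Icc]
        have := Nat.div_le_self k m
        have := Nat.div_pos (Nat.le_of_dvd hk1 hmk) hm0
        omega
    · intro m _ hm
      refine Finset.sum_eq_zero fun P _ => Finset.sum_eq_zero fun j _ => ?_
      rw [if_neg]
      rintro rfl
      apply hm
      rw [Nat.mem_divisors]
      exact ⟨dvd_mul_right _ _, by omega⟩
  rw [e1, Finset.sum_congr rfl e2]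
  symm
  rw [Finset.sum_comm]
  refine sum_congr rfl fun m hm => ?_
  rw [Finset.sum_comm]
  refine sum_congr rfl fun P _ => ?_
  rw [Finset.sum_comm]
  refine sum_congr rfl fun j hj => ?_
  rw [Finset.sum_ite_eq]
  have : m * j ∈ Icc 1 d ↔ m * j ≤ d := by
    rw [mem_Icc] at *
    have := Nat.mul_le_mul hm.1 hj.1
    omega
  simp only [this]

/-- If the L-function has degree ≤ 2 then prime power sums are power sums. -/
lemma SS_eq (χ : F[X] → ℂ) (h1 : χ 1 = 1)
    (hmul : ∀ f g : F[X], f.Monic → g.Monic → χ (f * g) = χ f * χ g)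
    (hz : ∀ d, 3 ≤ d → ∑ h ∈ Mon F d, χ h = 0) :
    ∃ α β : ℂ, ∀ k, 1 ≤ k → SS χ k = -(α ^ k + β ^ k) := by
  set c : ℕ → ℂ := fun d => ∑ h ∈ Mon F d, χ h with hc
  have hc0 : c 0 = 1 := by
    have : Mon F 0 = {1} := by
      ext f
      rw [mem_Mon, mem_singleton]
      constructor
      · rintro ⟨a, b⟩; exact a.natDegree_eq_zero.1 b
      · rintro rfl; simp
    simp [hc, this, h1]
  obtain ⟨α, hα⟩ : ∃ α : ℂ, α * α + c 1 * α + c 2 = 0 := by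
    have := IsAlgClosed.exists_root (X ^ 2 + C (c 1) * X + C (c 2) : ℂ[X]) (by
      have : (X ^ 2 + C (c 1) * X + C (c 2) : ℂ[X]).degree = 2 := by compute_degree!
      rw [this]; decide)
    obtain ⟨z, hz⟩ := this
    refine ⟨z, ?_⟩
    simp [IsRoot] at hz
    rw [← hz]; ring
  refine ⟨α, -c 1 - α, ?_⟩
  have hrec : ∀ d : ℕ, (d : ℂ) * c d = ∑ k ∈ Icc 1 d, SS χ k * c (d - k) := by
    exact log_deriv χ h1 hmul
  have r1 := hrec 1
  have r2 := hrec 2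
  have i2 : Icc 1 2 = ({1, 2} : Finset ℕ) := rfl
  simp [hc0] at r1
  rw [i2, Finset.sum_pair (by norm_num)] at r2
  simp [hc0] at r2
  intro k
  induction k using Nat.strong_induction_on with
  | _ k ih =>
    intro hk
    rcases Nat.lt_or_ge k 3 with hlt | hge
    · interval_cases k
      · rw [← r1]; ring
      · have : SS χ 2 = 2 * c 2 - c 1 * c 1 := by rw [r2, ← r1]; ring
        rw [this]
        linear_combination (2 : ℂ) * hα
    · obtain ⟨n, rfl⟩ : ∃ n, k = n + 3 := ⟨k - 3, by omega⟩
      have r := hrec (n + 3)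
      have hsub : ({n+1, n+2, n+3} : Finset ℕ) ⊆ Icc 1 (n+3) := by
        intro x; simp only [mem_insert, mem_singleton, mem_Icc]; omega
      rw [show c (n+3) = 0 from hz _ (by omega), mul_zero, ← Finset.sum_subset hsub] at r
      · rw [Finset.sum_insert (by simp), Finset.sum_pair (by simp)] at r
        rw [show n + 3 - (n+1) = 2 by omega, show n + 3 - (n+2) = 1 by omega, Nat.sub_self, hc0,
          ih (n+1) (by omega) (by omega), ih (n+2) (by omega) (by omega)] at r
        linear_combination -r + (α^(n+1) + (-c 1 - α)^(n+1)) * hα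
      · intro x hx hx'
        simp only [mem_insert, mem_singleton, mem_Icc] at hx hx'
        rw [show c (n + 3 - x) = 0 from hz _ (by omega), mul_zero]

end LFun
end PartP1

section PartP2
open Finset Polynomial

section Bridge
set_option linter.unusedSectionVars false
variable {F : Type} [Field F] [Fintype F] [DecidableEq F]
variable {K : Type} [Field K] [Fintype K] [DecidableEq K] [Algebra F K]

lemma card_minpoly_fiber (P : F[X]) (hPm : P.Monic) (hPi : Irreducible P)
    (hd : P.natDegree ∣ Module.finrank F K) :
    (univ.filter (fun x : K => minpoly F x = P)).card = P.natDegree := by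
  classical
  have hdvd := hPi.natDegree_dvd_iff_dvd_X_pow_card_pow_sub_X.1 hd
  rw [← Module.natCard_eq_pow_finrank, Nat.card_eq_fintype_card] at hdvd
  have hs := (FiniteField.isSplittingField_sub K F).splits
  have hsP : (P.map (algebraMap F K)).Splits := by
    refine Splits.of_dvd hs ?_ (Polynomial.map_dvd _ hdvd)
    exact map_ne_zero (FiniteField.X_pow_card_sub_X_ne_zero _ Fintype.one_lt_card)
  have hsep : P.Separable := PerfectField.separable_of_irreducible hPi
  rw [← card_rootSet_eq_natDegree hsep hsP, ← Set.toFinset_card]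
  congr 1
  ext x
  simp only [mem_filter, mem_univ, true_and, Set.mem_toFinset, mem_rootSet]
  constructor
  · rintro rfl; exact ⟨hPi.ne_zero, minpoly.aeval _ _⟩
  · rintro ⟨_, h⟩; exact (minpoly.eq_of_irreducible_of_monic hPi h hPm).symm

lemma sum_minpoly (g : F[X] → ℂ) :
    ∑ x : K, g (minpoly F x) =
      ∑ m ∈ (Module.finrank F K).divisors, ∑ P ∈ Irr F m, (m : ℂ) * g P := by
  classical
  have hn : Module.finrank F K ≠ 0 := Module.finrank_pos.ne'
  have e : ∀ m ∈ (Module.finrank F K).divisors, ∑ P ∈ Irr F m, (m : ℂ) * g P =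
      ∑ P ∈ Irr F m, (P.natDegree : ℂ) * g P := by
    intro m _
    refine sum_congr rfl fun P hP => ?_
    rw [(mem_Irr.1 hP).1.2]
  rw [Finset.sum_congr rfl e, ← Finset.sum_biUnion]
  swap
  · intro m _ m' _ hne
    rw [Function.onFun, Finset.disjoint_left]
    intro P hP hP'
    exact hne ((mem_Irr.1 hP).1.2.symm.trans (mem_Irr.1 hP').1.2)
  rw [← Finset.sum_fiberwise_of_maps_to (s := univ)
    (t := (Module.finrank F K).divisors.biUnion fun m => Irr F m) (g := fun x : K => minpoly F x)]
  · refine sum_congr rfl fun P hP => ?_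
    rw [mem_biUnion] at hP
    obtain ⟨m, hm, hP⟩ := hP
    obtain ⟨⟨hPm, hPd⟩, hPi⟩ := mem_Irr.1 hP
    rw [Finset.sum_congr rfl (g := fun _ => g P)]
    · rw [sum_const, card_minpoly_fiber P hPm hPi (by rw [hPd]; exact Nat.dvd_of_mem_divisors hm)]
      simp
    · intro x hx
      rw [(mem_filter.1 hx).2]
  · intro x _
    have hx : IsIntegral F x := IsIntegral.of_finite F x
    rw [mem_biUnion]
    exact ⟨(minpoly F x).natDegree, Nat.mem_divisors.2 ⟨minpoly.degree_dvd hx, hn⟩,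
      mem_Irr.2 ⟨⟨minpoly.monic hx, rfl⟩, minpoly.irreducible hx⟩⟩

lemma quadraticChar_norm (hF : ringChar F ≠ 2) (hK : ringChar K ≠ 2) (y : K) :
    quadraticChar F (Algebra.norm F y) = quadraticChar K y := by
  apply (quadraticChar_isQuadratic F).eq_of_eq_coe (quadraticChar_isQuadratic K) hK
  have h1 := quadraticChar_eq_pow_of_char_ne_two' hF (Algebra.norm F y)
  have h2 := quadraticChar_eq_pow_of_char_ne_two' hK y
  rw [h2]
  have h3 := congrArg (algebraMap F K) h1
  rw [map_intCast, map_pow, FiniteField.algebraMap_norm_eq_pow_sum, ← pow_mul] at h3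
  rw [h3]
  congr 1
  have hq : Odd (Fintype.card F) := Nat.odd_iff.2 (FiniteField.odd_card_of_char_ne_two hF)
  have hc : Fintype.card K = Fintype.card F ^ Module.finrank F K := Module.card_eq_pow_finrank
  rw [hc, Nat.card_eq_fintype_card]
  obtain ⟨r, hr⟩ := hq
  have hg := Nat.geomSum_eq (m := Fintype.card F) Fintype.one_lt_card (Module.finrank F K)
  have hg' := geom_sum_mul_add (R := ℕ) (2*r) (Module.finrank F K)
  rw [← hr] at hg'
  rw [← hg']
  rw [hr]
  rw [show (2 * r + 1) / 2 = r by omega, show (∑ i ∈ range (Module.finrank F K), (2 * r + 1) ^ i) * (2 * r) + 1 = 2 * ((∑ i ∈ range (Module.finrank F K), (2 * r + 1) ^ i) * r) + 1 by ring]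
  omega

abbrev QA (F : Type) [Field F] (D : F) := QuadraticAlgebra F D 0

lemma omega_sq (D : F) : (QuadraticAlgebra.omega : QA F D) * QuadraticAlgebra.omega =
    algebraMap F (QA F D) D := by
  rw [QuadraticAlgebra.omega_mul_omega_eq_algebraMap]; simp

lemma star_aeval (D : F) (h : F[X]) :
    star (aeval (QuadraticAlgebra.omega : QA F D) h) =
      aeval (-QuadraticAlgebra.omega : QA F D) h := by
  have h1 := Polynomial.hom_eval₂ h (algebraMap F (QA F D)) (starRingEnd (QA F D))
    QuadraticAlgebra.omega
  rw [starRingEnd_apply, starRingEnd_apply] at h1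
  rw [aeval_def, aeval_def, h1]
  congr 1
  · ext a <;> simp [starRingEnd_apply]
  · ext <;> simp

lemma norm_charpoly (D : F) {n : Type} [Fintype n] [DecidableEq n] (M : Matrix n n F) :
    QuadraticAlgebra.norm (aeval (QuadraticAlgebra.omega : QA F D) M.charpoly) =
      (M ^ 2 - Matrix.scalar n D).det := by
  have hinj : Function.Injective (algebraMap F (QA F D)) := by
    intro a b h
    simpa using congrArg QuadraticAlgebra.re h
  apply hinj
  rw [QuadraticAlgebra.algebraMap_norm_eq_mul_star, star_aeval]
  have key : ∀ w : QA F D, aeval w M.charpoly =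
      (Matrix.scalar n w - M.map (algebraMap F (QA F D))).det := by
    intro w
    rw [aeval_def, ← eval_map, ← Matrix.charpoly_map, Matrix.eval_charpoly]
  rw [key, key, ← Matrix.det_mul, RingHom.map_det]
  congr 1
  have hM : (algebraMap F (QA F D)).mapMatrix (M ^ 2 - Matrix.scalar n D) =
      (M.map (algebraMap F (QA F D))) ^ 2 - Matrix.scalar n (algebraMap F (QA F D) D) := by
    rw [map_sub, map_pow]
    congr 1
    refine Matrix.ext fun i j => ?_
    by_cases hij : i = j <;> simp [hij, Matrix.diagonal]
  rw [hM, ← omega_sq, map_mul, map_neg]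
  have hcomm := (Matrix.scalar_commute (n := n) (QuadraticAlgebra.omega : QA F D)
    (fun r => mul_comm _ _) (M.map (algebraMap F (QA F D)))).eq
  rw [sub_mul, mul_sub, mul_sub, mul_neg, mul_neg, hcomm, pow_two]
  abel

lemma norm_minpoly (D : F) (x : K) :
    Algebra.norm F (x ^ 2 - algebraMap F K D) =
      QuadraticAlgebra.norm (aeval (QuadraticAlgebra.omega : QA F D) (minpoly F x)) ^
        (Module.finrank F K / (minpoly F x).natDegree) := by
  classical
  have hx : IsIntegral F x := IsIntegral.of_finite F x
  let L := IntermediateField.adjoin F {x}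
  let pb := IntermediateField.adjoin.powerBasis hx
  have hg : pb.gen = IntermediateField.AdjoinSimple.gen F x :=
    IntermediateField.adjoin.powerBasis_gen hx
  have h1 : x ^ 2 - algebraMap F K D = algebraMap L K (pb.gen ^ 2 - algebraMap F L D) := by
    rw [hg, map_sub, map_pow, IntermediateField.AdjoinSimple.algebraMap_gen,
      ← IsScalarTower.algebraMap_apply]
  have hdeg : Module.finrank F L = (minpoly F x).natDegree :=
    IntermediateField.adjoin.finrank hx
  have hdiv : Module.finrank F K / (minpoly F x).natDegree = Module.finrank L K := by
    rw [← hdeg, ← Module.finrank_mul_finrank F L K,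
      Nat.mul_div_cancel_left _ Module.finrank_pos]
  rw [h1, hdiv, ← Algebra.norm_norm (S := L),
    Algebra.norm_algebraMap_of_basis (Module.Free.chooseBasis L K), map_pow,
    Module.finrank_eq_card_chooseBasisIndex]
  congr 1
  have h2 := norm_charpoly D (Algebra.leftMulMatrix pb.basis pb.gen)
  rw [charpoly_leftMulMatrix, hg, IntermediateField.minpoly_gen] at h2
  rw [h2, Algebra.norm_eq_matrix_det pb.basis, map_sub, map_pow, hg, AlgHom.commutes]
  rfl

/-- The character on monic polynomials. -/
noncomputable def chi (ψ : AddChar F ℂ) (D : F) (h : F[X]) : ℂ :=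
  ψ (-h.nextCoeff) *
    ((quadraticChar F (QuadraticAlgebra.norm (aeval (QuadraticAlgebra.omega : QA F D) h)) : ℤ) : ℂ)

lemma chi_one (ψ : AddChar F ℂ) (D : F) : chi ψ D 1 = 1 := by
  simp [chi, nextCoeff]

lemma chi_mul (ψ : AddChar F ℂ) (D : F) (f g : F[X]) (hf : f.Monic) (hg : g.Monic) :
    chi ψ D (f * g) = chi ψ D f * chi ψ D g := by
  simp only [chi, hf.nextCoeff_mul hg, map_mul, neg_add, AddChar.map_add_eq_mul, Int.cast_mul]
  ring

lemma chi_sum_zero (ψ : AddChar F ℂ) (hψ : ψ ≠ 0) (D : F) (d : ℕ) (hd : 3 ≤ d) :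
    ∑ h ∈ Mon F d, chi ψ D h = 0 := by
  obtain ⟨c, hc⟩ := (AddChar.ne_zero_iff).1 hψ
  obtain ⟨e, rfl⟩ : ∃ e, d = e + 3 := ⟨d - 3, by omega⟩
  have hdeg : ∀ c : F, (C c * (X ^ e * (X ^ 2 - C D))).degree < ((e + 3 : ℕ) : WithBot ℕ) := by
    intro c
    have : (C c * (X ^ e * (X ^ 2 - C D)) : F[X]).degree ≤ ((e + 2 : ℕ) : WithBot ℕ) := by
      compute_degree
      push_cast; rfl
    exact this.trans_lt (by exact_mod_cast Nat.lt_succ_self _)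
  have hmem : ∀ c : F, ∀ h ∈ Mon F (e+3), h + C c * (X ^ e * (X ^ 2 - C D)) ∈ Mon F (e+3) := by
    intro c h hh
    obtain ⟨h1, h2⟩ := mem_Mon.1 hh
    have hlt : (C c * (X ^ e * (X ^ 2 - C D))).degree < h.degree := by
      rw [degree_eq_natDegree h1.ne_zero, h2]; exact hdeg c
    rw [mem_Mon]
    refine ⟨h1.add_of_left hlt, ?_⟩
    rw [natDegree_add_eq_left_of_degree_lt hlt, h2]
  have key : ∑ h ∈ Mon F (e+3), chi ψ D h = ψ c * ∑ h ∈ Mon F (e+3), chi ψ D h := by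
    rw [Finset.mul_sum]
    symm
    refine Finset.sum_bij' (fun h _ => h + C (-c) * (X ^ e * (X ^ 2 - C D)))
      (fun h _ => h + C c * (X ^ e * (X ^ 2 - C D))) (hmem (-c)) (hmem c) ?_ ?_ ?_
    · intro h _; simp
    · intro h _; simp
    · intro h hh
      have hn : ∀ f ∈ Mon F (e+3), f.nextCoeff = f.coeff (e+2) := by
        intro f hf
        rw [nextCoeff_of_natDegree_pos (by rw [(mem_Mon.1 hf).2]; omega), (mem_Mon.1 hf).2]
        rfl
      have hco : (C (-c) * (X ^ e * (X ^ 2 - C D)) : F[X]).coeff (e+2) = -c := by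
        rw [coeff_C_mul, add_comm e 2, coeff_X_pow_mul]
        simp [coeff_X_pow]
      have hae : aeval (QuadraticAlgebra.omega : QA F D) (h + C (-c) * (X ^ e * (X ^ 2 - C D))) =
          aeval (QuadraticAlgebra.omega : QA F D) h := by
        have : aeval (QuadraticAlgebra.omega : QA F D) (X ^ 2 - C D) = 0 := by
          rw [map_sub, map_pow, aeval_X, aeval_C, pow_two,
            omega_sq, sub_self]
        rw [map_add, map_mul, map_mul, this]; simp
      simp only [chi]
      rw [hae, hn _ hh, hn _ (hmem (-c) h hh), coeff_add, hco, neg_add, neg_neg,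
        AddChar.map_add_eq_mul]
      ring
  have h3 : (ψ c - 1) * ∑ h ∈ Mon F (e+3), chi ψ D h = 0 := by
    rw [sub_mul, one_mul, ← key, sub_self]
  exact (mul_eq_zero.1 h3).resolve_left (sub_ne_zero.2 hc)

lemma SS_chi (hF : ringChar F ≠ 2) (hK : ringChar K ≠ 2) (ψ : AddChar F ℂ) (D : F) :
    SS (chi ψ D) (Module.finrank F K) =
      ∑ x : K, ψ (Algebra.trace F K x) *
        ((quadraticChar K (x ^ 2 - algebraMap F K D) : ℤ) : ℂ) := by
  rw [SS]
  have h := sum_minpoly (F := F) (K := K)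
    (fun P => chi ψ D P ^ (Module.finrank F K / P.natDegree))
  have e : ∀ m ∈ (Module.finrank F K).divisors, ∑ P ∈ Irr F m, (m : ℂ) *
      chi ψ D P ^ (Module.finrank F K / P.natDegree) =
      ∑ P ∈ Irr F m, (m : ℂ) * chi ψ D P ^ (Module.finrank F K / m) := by
    intro m _
    refine sum_congr rfl fun P hP => ?_
    rw [(mem_Irr.1 hP).1.2]
  rw [Finset.sum_congr rfl e] at h
  rw [← h]
  refine sum_congr rfl fun x _ => ?_
  have hx : IsIntegral F x := IsIntegral.of_finite F x
  rw [chi, mul_pow, ← quadraticChar_norm hF hK, norm_minpoly D x, map_pow, Int.cast_pow,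
    trace_eq_finrank_mul_minpoly_nextCoeff]
  congr 1
  have hdiv : Module.finrank F K / (minpoly F x).natDegree =
      Module.finrank (IntermediateField.adjoin F {x}) K := by
    rw [← IntermediateField.adjoin.finrank hx,
      ← Module.finrank_mul_finrank F (IntermediateField.adjoin F {x}) K,
      Nat.mul_div_cancel_left _ Module.finrank_pos]
  rw [hdiv, ← AddChar.map_nsmul_eq_pow, nsmul_eq_mul]

end Bridge
end PartP2

section PartP3
open Finset Polynomial

section Step
set_option linter.unusedSectionVars false
variable {F : Type} [Field F] [Fintype F] [DecidableEq F]

lemma expand_pow_card (k : ℕ) (f : F[X]) :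
    expand F (Fintype.card F ^ k) f = f ^ (Fintype.card F ^ k) := by
  induction k with
  | zero => simp
  | succ k ih => rw [pow_succ', expand_mul, ih, map_pow, FiniteField.expand_card, ← pow_mul]

lemma sq_eq_squarefree {a b g : F[X]} (h : a ^ 2 = b ^ 2 * g) (hg : Squarefree g)
    (hu : ¬ IsUnit g) : b = 0 := by
  by_contra hb
  have h1 : b ^ 2 ∣ a ^ 2 := ⟨g, h⟩
  obtain ⟨c, rfl⟩ := (UniqueFactorizationMonoid.pow_dvd_pow_iff_dvd (two_ne_zero)).1 h1
  rw [mul_pow] at h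
  have h2 := mul_left_cancel₀ (pow_ne_zero 2 hb) h
  have h3 : IsUnit c := hg c ⟨1, by rw [← h2]; ring⟩
  exact hu (h2 ▸ h3.pow 2)

lemma stepanov_kernel (f : F[X]) (R s q M : ℕ) (hR : R = 2 * (q + s) + 1)
    (hM : M = 2 * q + s + 1)
    (hs : q ^ 2 ≤ s) (hdeg : f.natDegree ≤ 2 * q) :
    ∃ a b : Fin M → F[X], (∀ j, (a j).natDegree ≤ s) ∧ (∀ j, (b j).natDegree ≤ s) ∧
      (∃ j, a j ≠ 0 ∨ b j ≠ 0) ∧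
      ∑ j : Fin M, (expand F R (a j) - expand F R (b j) * f ^ (q + s + 1)) * X ^ (j : ℕ) = 0 := by
  classical
  let Φ : (Fin M → (degreeLT F (s+1) × degreeLT F (s+1))) →ₗ[F] F[X] :=
    { toFun := fun v => ∑ j : Fin M, (expand F R (v j).1 - expand F R (v j).2 * f ^ (q + s + 1)) * X ^ (j : ℕ)
      map_add' := by
        intro v w
        rw [← Finset.sum_add_distrib]
        refine sum_congr rfl fun j _ => ?_
        simp only [Pi.add_apply, Prod.fst_add, Prod.snd_add, Submodule.coe_add, map_add]
        ring
      map_smul' := by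
        intro c v
        rw [RingHom.id_apply, Finset.smul_sum]
        refine sum_congr rfl fun j _ => ?_
        simp only [Pi.smul_apply, Prod.smul_fst, Prod.smul_snd, Submodule.coe_smul, smul_eq_C_mul, map_mul, expand_C]
        ring }
  have hΦ : ∀ v, Φ v = ∑ j : Fin M,
    (expand F R (v j).1 - expand F R (v j).2 * f ^ (q + s + 1)) * X ^ (j : ℕ) := fun v => rfl
  have hnd : ∀ g : degreeLT F (s+1), (g : F[X]).natDegree ≤ s := by
    intro g
    have := mem_degreeLT.1 g.2
    exact natDegree_le_of_degree_le (Order.le_of_lt_succ this)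
  obtain ⟨T, hT⟩ : ∃ T, T = R * s + 2 * q * (q + s + 1) + M := ⟨_, rfl⟩
  have hΦdeg : ∀ v, (Φ v).natDegree < T := by
    intro v
    rw [hΦ]
    refine lt_of_le_of_lt (natDegree_sum_le_of_forall_le (n := T - 1) _ _ ?_) (by omega)
    intro j _
    have h1 : (expand F R ((v j).1 : F[X])).natDegree ≤ R * s := by
      rw [natDegree_expand, mul_comm]; exact Nat.mul_le_mul_left _ (hnd _)
    have h2 : (expand F R ((v j).2 : F[X])).natDegree ≤ R * s := by
      rw [natDegree_expand, mul_comm]; exact Nat.mul_le_mul_left _ (hnd _)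
    have h3 : (f ^ (q + s + 1)).natDegree ≤ 2 * q * (q + s + 1) := by
      refine natDegree_pow_le.trans ?_
      rw [mul_comm]; exact Nat.mul_le_mul_right _ hdeg
    have h4 := natDegree_sub_le (expand F R ((v j).1 : F[X])) (expand F R ((v j).2 : F[X]) * f ^ (q + s + 1))
    have h5 := natDegree_mul_le (p := expand F R ((v j).2 : F[X])) (q := f ^ (q + s + 1))
    have h6 := natDegree_mul_le (p := expand F R ((v j).1 : F[X]) - expand F R ((v j).2 : F[X]) * f ^ (q + s + 1))
      (q := X ^ (j : ℕ))
    rw [natDegree_X_pow] at h6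
    have h7 := j.2
    have h8 : max (expand F R ((v j).1 : F[X])).natDegree
      (expand F R ((v j).2 : F[X]) * f ^ (q + s + 1)).natDegree ≤ R * s + 2 * q * (q + s + 1) :=
      max_le (by omega) (by omega)
    omega
  let Ψ : (Fin M → (degreeLT F (s+1) × degreeLT F (s+1))) →ₗ[F] (Fin T → F) :=
    LinearMap.pi (fun i : Fin T => (lcoeff F i).comp Φ)
  obtain ⟨v, hv, hv0⟩ : ∃ v, Φ v = 0 ∧ v ≠ 0 := by
    have e : Module.finrank F (degreeLT F (s+1)) = s + 1 := by
      rw [(degreeLTEquiv F (s+1)).finrank_eq]; simp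
    have hfin : Module.Finite F (degreeLT F (s+1)) :=
      Module.Finite.equiv (degreeLTEquiv F (s+1)).symm
    have hlt : Module.finrank F (Fin T → F) <
        Module.finrank F (Fin M → (degreeLT F (s+1) × degreeLT F (s+1))) := by
      rw [Module.finrank_fin_fun, Module.finrank_pi_fintype]
      simp only [Module.finrank_prod, e, sum_const, card_univ, Fintype.card_fin, smul_eq_mul]
      rw [hT, hM, hR]
      nlinarith
    have hk := LinearMap.ker_ne_bot_of_finrank_lt (f := Ψ) hlt
    obtain ⟨v, hv, hv0⟩ := Submodule.exists_mem_ne_zero_of_ne_bot hk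
    refine ⟨v, ?_, hv0⟩
    ext i
    by_cases hi : i < T
    · have := congrFun (LinearMap.mem_ker.1 hv) ⟨i, hi⟩
      exact this
    · rw [coeff_eq_zero_of_natDegree_lt ((hΦdeg v).trans_le (not_lt.1 hi))]; simp
  refine ⟨fun j => (v j).1, fun j => (v j).2, fun j => hnd _, fun j => hnd _, ?_, (hΦ v).symm.trans hv⟩
  by_contra! hcon
  exact hv0 (funext fun j => Prod.ext (Subtype.ext (hcon j).1) (Subtype.ext (hcon j).2))

set_option maxHeartbeats 1000000 in
/-- Stepanov–Bombieri bound -/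
lemma stepanov {K : Type} [Field K] [Fintype K] [DecidableEq K] [Algebra F K]
    (f : F[X]) (k s q : ℕ) (hq : Fintype.card F = q) (hR : q ^ k = 2 * (q + s) + 1)
    (hs : q ^ 2 ≤ s) (hK : Fintype.card K = (q ^ k) ^ 2)
    (hdeg : f.natDegree ≤ 2 * q) (hf0 : f.coeff 0 ≠ 0) (hsq : Squarefree f) (hu : ¬ IsUnit f) :
    (univ.filter (fun x : K => (aeval x f) ^ (Fintype.card K / 2) = -1)).card ≤
      s + 2 * q * (q + s + 1) + (2 * q + s) * q ^ k := by
  classical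
  obtain ⟨R, hRdef⟩ : ∃ R, R = q ^ k := ⟨_, rfl⟩
  rw [← hRdef] at hR hK ⊢
  have hexp : ∀ g : F[X], expand F R g = g ^ R := by
    intro g; rw [hRdef, ← hq]; exact expand_pow_card k g
  have hRpos : 0 < R := by omega
  obtain ⟨M, hM⟩ : ∃ M, M = 2 * q + s + 1 := ⟨_, rfl⟩
  obtain ⟨a', b', hna, hnb, hab, hv⟩ := stepanov_kernel f R s q M hR hM hs hdeg
  set W : F[X] := ∑ j : Fin M, (a' j + b' j * f ^ (q + s + 1) : F[X]) * X ^ ((j : ℕ) * R) with hW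
  have hWdeg : W.natDegree ≤ s + 2 * q * (q + s + 1) + (2 * q + s) * R := by
    refine natDegree_sum_le_of_forall_le _ _ ?_
    intro j _
    have h1 := hna j
    have h2 := hnb j
    have h3 : (f ^ (q + s + 1)).natDegree ≤ 2 * q * (q + s + 1) := by
      refine natDegree_pow_le.trans ?_
      rw [mul_comm]; exact Nat.mul_le_mul_right _ hdeg
    have h4 := natDegree_add_le (a' j) (b' j * f ^ (q + s + 1))
    have h5 := natDegree_mul_le (p := (b' j)) (q := f ^ (q + s + 1))
    have h6 := natDegree_mul_le (p := (a' j) + b' j * f ^ (q + s + 1))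
      (q := X ^ ((j : ℕ) * R))
    rw [natDegree_X_pow] at h6
    have h7 : (j : ℕ) * R ≤ (2 * q + s) * R := Nat.mul_le_mul_right _ (by have := j.2; omega)
    have h8 : max (a' j).natDegree
      (b' j * f ^ (q + s + 1)).natDegree ≤ s + 2 * q * (q + s + 1) :=
      max_le (by omega) (by omega)
    omega
  have hW0 : W ≠ 0 := by
    intro hWz
    have hex : ∃ n, ∃ h : n < M, (a' ⟨n, h⟩ ≠ 0 ∨ b' ⟨n, h⟩ ≠ 0) := by
      obtain ⟨j, hj⟩ := hab
      exact ⟨j, j.2, hj⟩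
    obtain ⟨hn, hne⟩ := Nat.find_spec hex
    have hmin : ∀ j : Fin M, (j : ℕ) < Nat.find hex → a' j = 0 ∧ b' j = 0 := by
      intro j hj
      have := Nat.find_min hex hj
      push Not at this
      exact this j.2
    generalize Nat.find hex = n at hn hne hmin
    set a : F[X] := a' ⟨n, hn⟩ with ha
    set b : F[X] := b' ⟨n, hn⟩ with hb
    have hdvd : X ^ (n * R) * X ^ R ∣ X ^ (n * R) * (a + b * f ^ (q + s + 1)) := by
      have h1 := Finset.add_sum_erase univ (fun j : Fin M =>
        (a' j + b' j * f ^ (q + s + 1) : F[X]) * X ^ ((j : ℕ) * R)) (mem_univ ⟨n, hn⟩)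
      rw [← hW, hWz] at h1
      have h2 : X ^ (n * R) * (a + b * f ^ (q + s + 1)) = - ∑ j ∈ univ.erase (⟨n, hn⟩ : Fin M),
        (a' j + b' j * f ^ (q + s + 1) : F[X]) * X ^ ((j : ℕ) * R) := by
        rw [eq_neg_iff_add_eq_zero, ← h1, mul_comm]
      rw [h2, dvd_neg]
      refine Finset.dvd_sum fun j hj => ?_
      have hjn : (j : ℕ) ≠ n := fun h => (ne_of_mem_erase hj) (Fin.ext h)
      rcases lt_or_gt_of_ne hjn with h | h
      · rw [(hmin j h).1, (hmin j h).2]; simp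
      · rw [← pow_add]
        refine Dvd.dvd.mul_left (pow_dvd_pow _ ?_) _
        nlinarith
    have hdvd1 : (X : F[X]) ^ R ∣ a + b * f ^ (q + s + 1) :=
      (mul_dvd_mul_iff_left (pow_ne_zero _ X_ne_zero)).1 hdvd
    have hdvd2 : (X : F[X]) ^ R ∣ f ^ R - C (f.coeff 0) := by
      have e : f ^ R - C (f.coeff 0) = expand F R (f - C (f.coeff 0)) := by
        rw [map_sub, hexp, expand_C]
      have e2 : (X : F[X]) ∣ f - C (f.coeff 0) := by
        rw [X_dvd_iff]; simp
      obtain ⟨g, hg⟩ := e2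
      exact ⟨expand F R g, by rw [e, hg, map_mul, expand_X]⟩
    have hdvd3 : (X : F[X]) ^ R ∣ a ^ 2 - b ^ 2 * (f * C (f.coeff 0)) := by
      have e : a ^ 2 - b ^ 2 * (f * C (f.coeff 0)) =
          (a + b * f ^ (q + s + 1)) * (a - b * f ^ (q + s + 1)) +
            (b ^ 2 * f) * (f ^ R - C (f.coeff 0)) := by
        rw [hR]; ring
      rw [e]
      exact dvd_add (hdvd1.mul_right _) (hdvd2.mul_left _)
    have hz : a ^ 2 - b ^ 2 * (f * C (f.coeff 0)) = 0 := by
      by_contra hne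
      have h1 := natDegree_le_of_dvd hdvd3 hne
      rw [natDegree_X_pow] at h1
      have ha' : a.natDegree ≤ s := hna _
      have hb' : b.natDegree ≤ s := hnb _
      have h2 := natDegree_sub_le (a ^ 2) (b ^ 2 * (f * C (f.coeff 0)))
      have h3 := natDegree_mul_le (p := b ^ 2) (q := f * C (f.coeff 0))
      have h4 := natDegree_mul_C_le f (f.coeff 0)
      have h5 := natDegree_pow_le (p := a) (n := 2)
      have h6 := natDegree_pow_le (p := b) (n := 2)
      have h8 : max (a ^ 2).natDegree (b ^ 2 * (f * C (f.coeff 0))).natDegree ≤ 2 * s + 2 * q :=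
        max_le (by omega) (by omega)
      omega
    have hCu : IsUnit (C (f.coeff 0)) := isUnit_C.2 (isUnit_iff_ne_zero.2 hf0)
    have hassoc : Associated f (f * C (f.coeff 0)) := associated_mul_unit_right f _ hCu
    have hb0 : b = 0 := sq_eq_squarefree (sub_eq_zero.1 hz) (hassoc.squarefree_iff.1 hsq)
      (fun h => hu (hassoc.isUnit_iff.2 h))
    have ha0 : a = 0 := by
      rw [hb0] at hz
      simpa using hz
    exact hne.elim (fun h => h ha0) (fun h => h hb0)
  have hsub : (univ.filter (fun x : K => (aeval x f) ^ (Fintype.card K / 2) = -1)) ⊆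
      (W.aroots K).toFinset := by
    intro x hx
    rw [mem_filter] at hx
    rw [Multiset.mem_toFinset, mem_aroots]
    refine ⟨hW0, ?_⟩
    have hQ : Fintype.card K / 2 = 2 * (q + s) * (q + s + 1) := by
      rw [hK, hR, show (2 * (q + s) + 1)^2 = 2 * (2 * (q + s) * (q + s + 1)) + 1 by ring]
      omega
    have hxQ : x ^ (R * R) = x := by
      rw [← pow_two, ← hK]; exact FiniteField.pow_card x
    have hfx : (aeval x f) ^ ((q + s + 1) * R) = - (aeval x f) ^ (q + s + 1) := by
      have := hx.2
      rw [hQ] at this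
      rw [hR, show (q + s + 1) * (2 * (q + s) + 1) = 2 * (q + s) * (q + s + 1) + (q + s + 1) by ring,
        pow_add, this]; ring
    have hWx : (aeval x W) ^ R = aeval x (∑ j : Fin M,
        (expand F R (a' j) - expand F R (b' j) * f ^ (q + s + 1)) * X ^ (j : ℕ)) := by
      rw [← map_pow, ← hexp, hW, map_sum, map_sum, map_sum]
      refine sum_congr rfl fun j _ => ?_
      rw [map_mul, map_add, map_mul]
      simp only [map_mul, map_add, map_sub, map_pow, hexp, aeval_X]
      rw [mul_pow (aeval x (b' j)), ← pow_mul (aeval x f), hfx, ← pow_mul x, show (j:ℕ) * R * R = (R * R) * j by ring,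
        pow_mul x, hxQ]
      ring
    rw [hv, map_zero] at hWx
    exact pow_eq_zero_iff hRpos.ne' |>.1 hWx
  calc _ ≤ (W.aroots K).toFinset.card := Finset.card_le_card hsub
    _ ≤ Multiset.card (W.aroots K) := Multiset.toFinset_card_le _
    _ ≤ (W.map (algebraMap F K)).natDegree := card_roots' _
    _ = W.natDegree := natDegree_map _
    _ ≤ _ := hWdeg
end Step
end PartP3

section PartP4
open Finset Polynomial

section Low
set_option linter.unusedSectionVars false
variable {F : Type} [Field F] [Fintype F] [DecidableEq F]
variable {K : Type} [Field K] [Fintype K] [DecidableEq K] [Algebra F K]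

lemma card_hyperbola {D : K} (hD : D ≠ 0) :
    (univ.filter (fun p : K × K => p.1 * p.2 = D)).card = Fintype.card K - 1 := by
  have : (univ.filter (fun p : K × K => p.1 * p.2 = D)) =
      (univ.erase (0 : K)).image (fun u => (u, u⁻¹ * D)) := by
    ext ⟨u, v⟩
    simp only [mem_filter, mem_univ, true_and, mem_image, mem_erase, ne_eq, and_true, Prod.mk.injEq]
    constructor
    · rintro rfl
      have hu : u ≠ 0 := left_ne_zero_of_mul hD
      exact ⟨u, hu, rfl, by field_simp⟩
    · rintro ⟨a, ha, rfl, rfl⟩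
      field_simp
  rw [this, card_image_of_injective, card_erase_of_mem (mem_univ _), card_univ]
  intro a b h
  exact (Prod.mk.inj h).1

lemma sum_quad (hK : ringChar K ≠ 2) {D : K} (hD : D ≠ 0) :
    ∑ x : K, quadraticChar K (x ^ 2 - D) = -1 := by
  have h2 : (2 : K) ≠ 0 := Ring.two_ne_zero hK
  have h1 : ∑ x : K, (quadraticChar K (x ^ 2 - D) + 1) =
      ((univ.filter (fun p : K × K => p.2 ^ 2 = p.1 ^ 2 - D)).card : ℤ) := by
    rw [card_filter, Nat.cast_sum, ← univ_product_univ, sum_product]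
    refine sum_congr rfl fun x _ => ?_
    rw [← quadraticChar_card_sqrts hK, ← Nat.cast_sum, ← card_filter]
    congr 2
    ext y; simp
  have h3 : (univ.filter (fun p : K × K => p.2 ^ 2 = p.1 ^ 2 - D)).card =
      (univ.filter (fun p : K × K => p.1 * p.2 = D)).card := by
    refine card_bij (fun p _ => (p.1 + p.2, p.1 - p.2)) ?_ ?_ ?_
    · intro p hp
      simp only [mem_filter, mem_univ, true_and] at hp ⊢
      linear_combination - hp
    · intro p _ r _ h
      have ha := (Prod.mk.inj h).1
      have hb := (Prod.mk.inj h).2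
      ext
      · exact mul_left_cancel₀ h2 (by linear_combination ha + hb)
      · exact mul_left_cancel₀ h2 (by linear_combination ha - hb)
    · intro p hp
      simp only [mem_filter, mem_univ, true_and] at hp
      refine ⟨((p.1 + p.2) / 2, (p.1 - p.2) / 2), ?_, ?_⟩
      · simp only [mem_filter, mem_univ, true_and]
        field_simp
        linear_combination -4 * hp
      · ext <;> simp <;> field_simp <;> ring
  rw [h3, card_hyperbola hD, sum_add_distrib, Nat.cast_sub Fintype.card_pos] at h1
  rw [sum_const, card_univ, nsmul_eq_mul, mul_one] at h1
  push_cast at h1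
  linarith

/-- lower bound from Stepanov -/
lemma low_bound (hF : ringChar F ≠ 2) (hK2 : ringChar K ≠ 2) (D : F) (hD : D ≠ 0) (k q : ℕ)
    (hk : 3 ≤ k) (hq : Fintype.card F = q) (hK : Fintype.card K = (q ^ k) ^ 2) :
    -(6 * q * q ^ k : ℤ) ≤
      ∑ z : K, quadraticChar K ((z ^ q - z) ^ 2 - algebraMap F K D) := by
  classical
  have hqodd : q % 2 = 1 := hq ▸ FiniteField.odd_card_of_char_ne_two hF
  have hq1 : 1 < q := hq ▸ Fintype.one_lt_card
  have hq3 : 3 ≤ q := by omega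
  obtain ⟨s, hR, hs⟩ : ∃ s, q ^ k = 2 * (q + s) + 1 ∧ q ^ 2 ≤ s := by
    have h1 : q ^ 3 ≤ q ^ k := Nat.pow_le_pow_right (by omega) hk
    have h2 : 2 * (q ^ 2 + q) + 1 ≤ q ^ 3 := by nlinarith
    have h3 : q ^ k % 2 = 1 := by rw [Nat.pow_mod, hqodd]; simp
    refine ⟨(q ^ k - 1) / 2 - q, ?_, ?_⟩ <;> omega
  set f : F[X] := (X ^ q - X) ^ 2 - C D with hf
  have hnat : (X ^ q - X : F[X]).natDegree = q := FiniteField.X_pow_card_sub_X_natDegree_eq F hq1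
  have hdeg : f.natDegree = 2 * q := by
    rw [hf, natDegree_sub_C, natDegree_pow, hnat]
  have hf0 : f.coeff 0 = -D := by
    rw [coeff_zero_eq_eval_zero, hf]
    simp [show q ≠ 0 by omega]
  have hqF : (q : F) = 0 := by rw [← hq]; exact FiniteField.cast_card_eq_zero F
  have hsep : f.Separable := by
    have hd : derivative f = - (2 * (X ^ q - X)) := by
      rw [hf]
      simp only [derivative_sub, derivative_pow, derivative_X, derivative_C, hqF]
      simp only [Nat.cast_ofNat, map_ofNat, map_zero]
      ring
    rw [separable_def, hd]
    have h2 : (2 : F) ≠ 0 := Ring.two_ne_zero hF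
    refine ⟨- C (D⁻¹), - C (D⁻¹ * 2⁻¹) * (X ^ q - X), ?_⟩
    have e1 : (C (D⁻¹) * C D : F[X]) = 1 := by rw [← C_mul, inv_mul_cancel₀ hD, C_1]
    have e2 : (C (2⁻¹) * 2 : F[X]) = 1 := by
      rw [show (2 : F[X]) = C 2 from (map_ofNat C 2).symm, ← C_mul, inv_mul_cancel₀ h2, C_1]
    rw [hf, C_mul]
    linear_combination e1 + C (D⁻¹) * (X ^ q - X) ^ 2 * e2
  have hfne : f ≠ 0 := by
    intro h; rw [h] at hdeg; simp at hdeg; omega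
  have hst := stepanov (K := K) f k s q hq hR hs hK hdeg.le (by rw [hf0]; exact neg_ne_zero.2 hD)
    hsep.squarefree (fun h => by rw [natDegree_eq_zero_of_isUnit h] at hdeg; omega)
  have hev : ∀ z : K, aeval z f = (z ^ q - z) ^ 2 - algebraMap F K D := by
    intro z; rw [hf]; simp
  have hroots : (univ.filter (fun z : K => aeval z f = 0)).card ≤ 2 * q := by
    calc _ ≤ (f.aroots K).toFinset.card := by
          refine card_le_card fun z hz => ?_
          rw [Multiset.mem_toFinset, mem_aroots]
          exact ⟨hfne, (mem_filter.1 hz).2⟩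
      _ ≤ Multiset.card (f.aroots K) := Multiset.toFinset_card_le _
      _ ≤ (f.map (algebraMap F K)).natDegree := card_roots' _
      _ = 2 * q := by rw [natDegree_map, hdeg]
  have hpt : ∀ z : K, (1 : ℤ) - (if aeval z f = 0 then 1 else 0) -
      2 * (if (aeval z f) ^ (Fintype.card K / 2) = -1 then 1 else 0) ≤
      quadraticChar K ((z ^ q - z) ^ 2 - algebraMap F K D) := by
    intro z
    rw [← hev]
    by_cases h0 : aeval z f = 0
    · rw [h0]; simp
      split_ifs <;> norm_num
    · rcases quadraticChar_dichotomy h0 with h | h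
      · rw [h]
        split_ifs <;> norm_num
      · have := quadraticChar_eq_pow_of_char_ne_two' hK2 (aeval z f)
        rw [h] at this
        have h5 : aeval z f ^ (Fintype.card K / 2) = -1 := by rw [← this]; simp
        rw [if_pos h5, h, if_neg h0]
        norm_num
  have hsum := sum_le_sum (fun z (_ : z ∈ (univ : Finset K)) => hpt z)
  rw [sum_sub_distrib, sum_sub_distrib, ← mul_sum, sum_boole, sum_boole, sum_const, card_univ, hK] at hsum
  refine le_trans ?_ hsum
  have hst' : ((univ.filter (fun x : K => (aeval x f)^(Fintype.card K/2) = -1)).card : ℤ) ≤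
    s + 2*q*(q+s+1) + (2*q+s)*q^k := by exact_mod_cast hst
  have hroots' : ((univ.filter (fun z : K => aeval z f = 0)).card : ℤ) ≤ 2 * q := by exact_mod_cast hroots
  have hR' : (q : ℤ) ^ k = 2 * (q + s) + 1 := by exact_mod_cast hR
  rw [hK] at hst'
  simp only [nsmul_eq_mul, Nat.cast_pow, mul_one]
  rw [hR'] at hst' ⊢
  have : (0:ℤ) ≤ q := by positivity
  have : (0:ℤ) ≤ s := by positivity
  nlinarith

lemma fiber_card (q : ℕ) (hq : Fintype.card F = q) (x : K) :
    (univ.filter (fun z : K => z ^ q - z = x)).card = if Algebra.trace F K x = 0 then q else 0 := by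
  classical
  have hq1 : 1 < q := hq ▸ Fintype.one_lt_card
  have htr : ∀ z : K, Algebra.trace F K (z ^ q - z) = 0 := by
    intro z
    rw [map_sub, sub_eq_zero, ← hq]
    exact Algebra.trace_eq_of_algEquiv (FiniteField.frobeniusAlgEquivOfAlgebraic F K) z
  have hle : ∀ x : K, (univ.filter (fun z : K => z ^ q - z = x)).card ≤
      if Algebra.trace F K x = 0 then q else 0 := by
    intro x
    split_ifs with h
    · have hnat : (X ^ q - X - C x : K[X]).natDegree = q := by
        rw [natDegree_sub_C, FiniteField.X_pow_card_sub_X_natDegree_eq K hq1]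
      have hne : (X ^ q - X - C x : K[X]) ≠ 0 := by
        intro h; rw [h] at hnat; simp at hnat; omega
      calc _ ≤ (X ^ q - X - C x : K[X]).roots.toFinset.card := by
            refine card_le_card fun z hz => ?_
            rw [Multiset.mem_toFinset, mem_roots hne]
            simp [(mem_filter.1 hz).2]
        _ ≤ Multiset.card (X ^ q - X - C x : K[X]).roots := Multiset.toFinset_card_le _
        _ ≤ _ := card_roots' _
        _ = q := hnat
    · rw [Nat.le_zero, card_eq_zero, filter_eq_empty_iff]
      rintro z - rfl
      exact h (htr z)
  have htot : ∑ x : K, (univ.filter (fun z : K => z ^ q - z = x)).card =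
      ∑ x : K, if Algebra.trace F K x = 0 then q else 0 := by
    rw [← card_eq_sum_card_fiberwise (fun z _ => mem_univ _), ← sum_filter, sum_const, smul_eq_mul]
    have h1 : Fintype.card K = ∑ y : F, (univ.filter (fun x : K => Algebra.trace F K x = y)).card := by
      rw [← card_eq_sum_card_fiberwise (fun z _ => mem_univ _), card_univ]
    have hsurj := Algebra.trace_surjective F K
    have h2 : ∀ y : F, (univ.filter (fun x : K => Algebra.trace F K x = y)).card =
        (univ.filter (fun x : K => Algebra.trace F K x = 0)).card := by
      intro y
      obtain ⟨c, rfl⟩ := hsurj y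
      refine card_bij (fun x _ => x - c) ?_ ?_ ?_
      · intro x hx; simp only [mem_filter, mem_univ, true_and] at hx ⊢
        rw [map_sub, hx, sub_self]
      · intro a _ b _ h; exact sub_left_injective h
      · intro x hx; simp only [mem_filter, mem_univ, true_and] at hx
        exact ⟨x + c, by simp [hx], by simp⟩
    rw [card_univ, h1]
    simp_rw [h2]
    rw [sum_const, card_univ, hq, smul_eq_mul, mul_comm]
  have := (sum_eq_sum_iff_of_le (fun x (_ : x ∈ (univ : Finset K)) => hle x)).1 htot
  exact this x (mem_univ _)

lemma sum_all_psi (q : ℕ) (hq : Fintype.card F = q) (g : K → ℂ) :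
    ∑ ψ : AddChar F ℂ, ∑ x : K, ψ (Algebra.trace F K x) * g x = ∑ z : K, g (z ^ q - z) := by
  classical
  rw [sum_comm]
  have h1 : ∀ x : K, ∑ ψ : AddChar F ℂ, ψ (Algebra.trace F K x) * g x =
      ((univ.filter (fun z : K => z ^ q - z = x)).card : ℂ) * g x := by
    intro x
    rw [← sum_mul, AddChar.sum_apply_eq_ite, fiber_card q hq, hq]
    split_ifs <;> simp
  simp_rw [h1]
  rw [← sum_fiberwise_of_maps_to (s := univ) (t := univ) (g := fun z : K => z ^ q - z) (fun _ _ => mem_univ _)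
    (fun z => g (z ^ q - z))]
  refine sum_congr rfl fun x _ => ?_
  rw [sum_congr rfl (g := fun _ => g x) (by intro z hz; rw [(mem_filter.1 hz).2]), sum_const, nsmul_eq_mul]
end Low
end PartP4

section PartP5a
open Finset

lemma recur {ι : Type} [Fintype ι] (w : ι → ℂ) (N : ℕ) :
    ∃ k, N ≤ k ∧ ∀ i, ‖w i‖ ^ k / 2 ≤ (w i ^ k).re := by
  classical
  let u : ι → ℂ := fun i => if w i = 0 then 1 else w i / ‖w i‖
  have hu : ∀ i, ‖u i‖ = 1 := by
    intro i
    simp only [u]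
    split_ifs with h
    · simp
    · simp [h]
  have hwu : ∀ i, w i = ‖w i‖ * u i := by
    intro i
    simp only [u]
    split_ifs with h
    · simp [h]
    · have : (‖w i‖ : ℂ) ≠ 0 := by simpa using h
      field_simp
  have hb : ∀ n : ℕ, (fun i => u i ^ n) ∈ Metric.closedBall (0 : ι → ℂ) 1 := by
    intro n
    rw [mem_closedBall_zero_iff, pi_norm_le_iff_of_nonneg zero_le_one]
    intro i; rw [norm_pow, hu, one_pow]
  obtain ⟨a, -, φ, hφ, hlim⟩ := tendsto_subseq_of_bounded (Metric.isBounded_closedBall) hb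
  have hc := hlim.cauchySeq
  rw [Metric.cauchySeq_iff] at hc
  obtain ⟨n0, hn0⟩ := hc (1/2) (by norm_num)
  have hge : φ n0 + (N + 1) ≤ φ (n0 + (N + 1)) := by
    generalize N + 1 = m
    induction m with
    | zero => simp
    | succ m ih =>
      have := hφ (show n0 + m < n0 + (m + 1) by omega)
      omega
  have hd := hn0 (n0 + (N+1)) (by omega) n0 le_rfl
  refine ⟨φ (n0 + (N+1)) - φ n0, by omega, fun i => ?_⟩
  obtain ⟨k, hk⟩ : ∃ k, φ (n0 + (N+1)) = φ n0 + k := ⟨φ (n0 + (N+1)) - φ n0, by omega⟩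
  have hdi := (dist_le_pi_dist _ _ i).trans_lt hd
  simp only [Function.comp] at hdi
  rw [hk, Nat.add_sub_cancel_left]
  rw [hk, dist_eq_norm, pow_add, show u i ^ φ n0 * u i ^ k - u i ^ φ n0 = u i ^ φ n0 * (u i ^ k - 1) by ring,
    norm_mul, norm_pow, hu, one_pow, one_mul] at hdi
  have hre : (1:ℝ)/2 ≤ (u i ^ k).re := by
    have := (Complex.abs_re_le_norm (u i ^ k - 1)).trans hdi.le
    rw [Complex.sub_re, Complex.one_re, abs_le] at this
    linarith [this.1]
  have e : (w i ^ k).re = ‖w i‖ ^ k * (u i ^ k).re := by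
    conv_lhs => rw [hwu i, mul_pow, ← Complex.ofReal_pow, Complex.re_ofReal_mul]
  rw [e]
  have := pow_nonneg (norm_nonneg (w i)) k
  nlinarith

lemma norm_le_of_sum {ι : Type} [Fintype ι] (α : ι → ℂ) (C r : ℝ) (hr : 0 < r) (k0 : ℕ)
    (h : ∀ k, k0 ≤ k → (∑ i, α i ^ (2 * k)).re ≤ C * r ^ k) (i : ι) : ‖α i‖ ≤ Real.sqrt r := by
  by_contra! hlt
  have h1 : 1 < ‖α i ^ 2‖ / r := by
    rw [one_lt_div hr, norm_pow]
    exact (Real.sqrt_lt' ((Real.sqrt_nonneg r).trans_lt hlt)).1 hlt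
  obtain ⟨n, hn⟩ := (tendsto_pow_atTop_atTop_of_one_lt h1).eventually_gt_atTop (2 * C) |>.exists_forall_of_atTop
  obtain ⟨k, hk, hre⟩ := recur (fun i => α i ^ 2) (max k0 n)
  have h2 := h k (le_trans (le_max_left _ _) hk)
  have h3 := hn k (le_trans (le_max_right _ _) hk)
  rw [Complex.re_sum] at h2
  have h4 : ‖α i ^ 2‖ ^ k / 2 ≤ ∑ j, (α j ^ (2 * k)).re := by
    refine (hre i).trans ?_
    rw [← pow_mul]
    refine single_le_sum (f := fun j => (α j ^ (2 * k)).re) (fun j _ => ?_) (mem_univ i)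
    have := hre j
    rw [← pow_mul] at this
    exact le_trans (by positivity) this
  rw [div_pow, lt_div_iff₀ (by positivity)] at h3
  linarith
end PartP5a

section PartP5b
open Finset Polynomial

section Weil
set_option linter.unusedSectionVars false
variable {F : Type} [Field F] [Fintype F] [DecidableEq F]

lemma sum_SS_K {K : Type} [Field K] [Fintype K] [DecidableEq K] [Algebra F K]
    (hF : ringChar F ≠ 2) (D : F) (hD : D ≠ 0) (k : ℕ) (hk : 3 ≤ k)
    (hK : Fintype.card K = (Fintype.card F ^ k) ^ 2) (hrk : Module.finrank F K = 2 * k) :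
    -(6 * Fintype.card F * Fintype.card F ^ k : ℝ) ≤
      (∑ ψ : {ψ : AddChar F ℂ // ψ ≠ 0}, SS (chi ψ.1 D) (2 * k)).re := by
  classical
  have hK2 : ringChar K ≠ 2 := by
    rw [← Algebra.ringChar_eq F K]; exact hF
  have h1 := sum_all_psi (F := F) (K := K) (Fintype.card F) rfl
    (fun x => ((quadraticChar K (x ^ 2 - algebraMap F K D) : ℤ) : ℂ))
  have h2 := low_bound (K := K) hF hK2 D hD k (Fintype.card F) hk rfl hK
  simp_rw [← SS_chi hF hK2, hrk] at h1
  have h0 : SS (chi (0 : AddChar F ℂ) D) (2 * k) = -1 := by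
    rw [← hrk, SS_chi hF hK2]
    simp only [AddChar.zero_apply, one_mul]
    rw [← Int.cast_sum, sum_quad hK2 (by simpa using hD)]
    simp
  have h3 := Fintype.sum_eq_add_sum_subtype_ne (fun ψ : AddChar F ℂ => SS (chi ψ D) (2 * k)) 0
  rw [h0, h1, ← Int.cast_sum] at h3
  have h4 := congrArg Complex.re h3
  rw [Complex.intCast_re, Complex.add_re, Complex.neg_re, Complex.one_re] at h4
  have h5 := (Int.cast_le (R := ℝ)).2 h2
  push_cast at h5 h4
  linarith

lemma sum_SS (hF : ringChar F ≠ 2) (D : F) (hD : D ≠ 0) (k : ℕ) (hk : 3 ≤ k) :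
    -(6 * Fintype.card F * Fintype.card F ^ k : ℝ) ≤
      (∑ ψ : {ψ : AddChar F ℂ // ψ ≠ 0}, SS (chi ψ.1 D) (2 * k)).re := by
  classical
  have : Fact (ringChar F).Prime := ⟨CharP.char_is_prime F (ringChar F)⟩
  have : NeZero (2 * k) := ⟨by omega⟩
  let _ : Fintype (FiniteField.Extension F (ringChar F) (2 * k)) := Fintype.ofFinite _
  refine sum_SS_K (K := FiniteField.Extension F (ringChar F) (2 * k)) hF D hD k hk ?_ ?_
  · have := FiniteField.natCard_extension F (ringChar F) (2 * k)
    rw [Nat.card_eq_fintype_card, Nat.card_eq_fintype_card] at this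
    rw [this, ← pow_mul, mul_comm]
  · exact FiniteField.finrank_extension F (ringChar F) (2 * k)

lemma weil (hF : ringChar F ≠ 2) (ψ : AddChar F ℂ) (hψ : ψ ≠ 0) (D : F) (hD : D ≠ 0) :
    ‖∑ x : F, ψ x * ((quadraticChar F (x ^ 2 - D) : ℤ) : ℂ)‖ ≤ 2 * Real.sqrt (Fintype.card F) := by
  classical
  have hex : ∀ ψ : {ψ : AddChar F ℂ // ψ ≠ 0}, ∃ α β : ℂ, ∀ k, 1 ≤ k →
      SS (chi ψ.1 D) k = -(α ^ k + β ^ k) := fun ψ =>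
    SS_eq (chi ψ.1 D) (chi_one _ _) (chi_mul _ _) (chi_sum_zero ψ.1 ψ.2 D)
  choose α β hab using hex
  have hq : (0 : ℝ) < Fintype.card F := by exact_mod_cast Fintype.card_pos
  have hbd := norm_le_of_sum (Sum.elim α β) (6 * Fintype.card F) (Fintype.card F) hq 3 (by
    intro k hk
    have := sum_SS hF D hD k hk
    rw [sum_congr rfl (fun ψ _ => hab ψ (2 * k) (by omega)), sum_neg_distrib, sum_add_distrib] at this
    rw [Fintype.sum_sum_type]
    simp only [Sum.elim_inl, Sum.elim_inr]
    rw [Complex.neg_re] at this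
    linarith)
  have h1 := SS_chi (K := F) hF hF ψ D
  simp only [Module.finrank_self, Algebra.trace_self_apply, Algebra.algebraMap_self, RingHom.id_apply] at h1
  rw [← h1, hab ⟨ψ, hψ⟩ 1 le_rfl, norm_neg, pow_one, pow_one]
  have ha := hbd (Sum.inl ⟨ψ, hψ⟩)
  have hb := hbd (Sum.inr ⟨ψ, hψ⟩)
  simp only [Sum.elim_inl, Sum.elim_inr] at ha hb
  exact (norm_add_le _ _).trans (by linarith)
end Weil
end PartP5b

section PartP6
open Finset Polynomial

section Four
set_option linter.unusedSectionVars false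
variable {F : Type} [Field F] [Fintype F] [DecidableEq F]

lemma quad_neg (c s : F) :
    quadraticChar F (c - s ^ 2) = quadraticChar F (-1) * quadraticChar F (s ^ 2 - c) := by
  rw [← map_mul]; congr 1; ring

lemma norm_quad_neg_one : ‖((quadraticChar F (-1) : ℤ) : ℂ)‖ ≤ 1 := by
  rcases quadraticChar_dichotomy (F := F) (a := -1) (by simp) with h | h <;> rw [h] <;> simp

lemma circle_sum (hF : ringChar F ≠ 2) (g : F → ℂ) (c : F) :
    ∑ p ∈ univ.filter (fun p : F × F => p.1 ^ 2 + p.2 ^ 2 = c), g p.1 =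
      ∑ s : F, g s + ((quadraticChar F (-1) : ℤ) : ℂ) *
        ∑ s : F, g s * ((quadraticChar F (s ^ 2 - c) : ℤ) : ℂ) := by
  rw [sum_filter, ← univ_product_univ, sum_product, mul_sum, ← sum_add_distrib]
  refine sum_congr rfl fun s _ => ?_
  rw [← sum_filter]
  dsimp only
  rw [sum_const]
  have h := quadraticChar_card_sqrts hF (c - s ^ 2)
  have e : ({x | x ^ 2 = c - s ^ 2} : Set F).toFinset = univ.filter (fun y : F => s ^ 2 + y ^ 2 = c) := by
    ext y; simp [eq_sub_iff_add_eq, add_comm]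
  rw [e, quad_neg] at h
  have h' := congrArg (Int.cast : ℤ → ℂ) h
  push_cast at h'
  rw [nsmul_eq_mul, h']
  ring

lemma circle_card (hF : ringChar F ≠ 2) {t : F} (ht : t ≠ 0) :
    |((univ.filter (fun p : F × F => nrm p = t)).card : ℝ) - Fintype.card F| ≤ 1 := by
  have h := circle_sum hF (fun _ => 1) t
  simp only [one_mul] at h
  rw [← Int.cast_sum, sum_quad hF ht, sum_const, sum_const, card_univ] at h
  have h2 : (univ.filter (fun p : F × F => nrm p = t)) =
    univ.filter (fun p : F × F => p.1 ^ 2 + p.2 ^ 2 = t) := rfl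
  rw [h2]
  have h3 : ((univ.filter (fun p : F × F => p.1 ^ 2 + p.2 ^ 2 = t)).card : ℂ) - Fintype.card F =
      - ((quadraticChar F (-1) : ℤ) : ℂ) := by
    simp only [nsmul_eq_mul, mul_one] at h
    rw [h]; simp
  have h4 := norm_quad_neg_one (F := F)
  rw [← norm_neg, ← h3] at h4
  rw [← Complex.ofReal_natCast, ← Complex.ofReal_natCast, ← Complex.ofReal_sub, Complex.norm_real] at h4
  exact h4

lemma four_aux (hF : ringChar F ≠ 2) {t : F} (ht : t ≠ 0) (ψ : AddChar F ℂ) (hψ : ψ ≠ 0)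
    (a b : F) (hab : ¬ (a = 0 ∧ b = 0)) :
    ‖∑ p ∈ univ.filter (fun p : F × F => nrm p = t), ψ (a * p.1 + b * p.2)‖ ≤
      2 * Real.sqrt (Fintype.card F) := by
  have h2 : (2 : F) ≠ 0 := Ring.two_ne_zero hF
  have hsum0 : ∑ x : F, ψ x = 0 := by rw [AddChar.sum_eq_ite, if_neg hψ]
  have hq1 : 1 ≤ Real.sqrt (Fintype.card F) := by
    rw [Real.one_le_sqrt]; exact_mod_cast Fintype.card_pos
  by_cases hr : a ^ 2 + b ^ 2 = 0
  · have ha : a ≠ 0 := by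
      rintro rfl; exact hab ⟨rfl, by simpa using hr⟩
    have hb : b ≠ 0 := by
      rintro rfl; exact ha (by simpa using hr)
    have e : ∑ p ∈ univ.filter (fun p : F × F => nrm p = t), ψ (a * p.1 + b * p.2) =
        ∑ u ∈ univ.erase (0 : F), ψ u := by
      refine sum_bij (fun p _ => a * p.1 + b * p.2) ?_ ?_ ?_ ?_
      · intro p hp
        simp only [mem_filter, mem_univ, true_and] at hp
        unfold nrm at hp
        refine mem_erase.2 ⟨fun h => ?_, mem_univ _⟩
        have : a ^ 2 * t = 0 := by
          linear_combination (-a^2) * hp + (a * p.1 - b * p.2) * h + p.2 ^ 2 * hr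
        exact (mul_ne_zero (pow_ne_zero 2 ha) ht) this
      · intro p hp r hr' h
        simp only [mem_filter, mem_univ, true_and] at hp hr'
        unfold nrm at hp hr'
        have hu : a * p.1 + b * p.2 ≠ 0 := by
          intro h
          have : a ^ 2 * t = 0 := by
            linear_combination (-a^2) * hp + (a * p.1 - b * p.2) * h + p.2 ^ 2 * hr
          exact (mul_ne_zero (pow_ne_zero 2 ha) ht) this
        have hv : a * p.1 - b * p.2 = a * r.1 - b * r.2 := by
          apply mul_left_cancel₀ hu
          linear_combination a ^ 2 * hp - a ^ 2 * hr' - p.2 ^ 2 * hr + r.2 ^ 2 * hr - (a * r.1 - b * r.2) * h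
        ext
        · apply mul_left_cancel₀ (mul_ne_zero h2 ha); linear_combination h + hv
        · apply mul_left_cancel₀ (mul_ne_zero h2 hb); linear_combination h - hv
      · intro u hu
        have hu0 : u ≠ 0 := (mem_erase.1 hu).1
        refine ⟨((u + a ^ 2 * t / u) / (2 * a), (u - a ^ 2 * t / u) / (2 * b)), ?_, ?_⟩
        · simp only [mem_filter, mem_univ, true_and]
          unfold nrm
          dsimp only
          have hb2 : b ^ 2 = - a ^ 2 := by linear_combination hr
          rw [div_pow, div_pow, mul_pow 2 b, hb2]
          field_simp
          ring
        · field_simp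
          ring
      · intro p _; rfl
    have e2 := add_sum_erase univ (fun u => ψ u) (mem_univ (0:F))
    rw [hsum0, AddChar.map_zero_eq_one] at e2
    rw [e, show ∑ u ∈ univ.erase (0 : F), ψ u = -1 by linear_combination e2, norm_neg, norm_one]
    linarith
  · have e : ∑ p ∈ univ.filter (fun p : F × F => nrm p = t), ψ (a * p.1 + b * p.2) =
        ∑ p ∈ univ.filter (fun p : F × F => p.1 ^ 2 + p.2 ^ 2 = (a ^ 2 + b ^ 2) * t), ψ p.1 := by
      refine sum_bij (fun p _ => (a * p.1 + b * p.2, - b * p.1 + a * p.2)) ?_ ?_ ?_ ?_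
      · intro p hp
        simp only [mem_filter, mem_univ, true_and] at hp ⊢
        unfold nrm at hp
        rw [← hp]; ring
      · intro p _ r _ h
        have h1 := (Prod.mk.inj h).1
        have h2 := (Prod.mk.inj h).2
        ext <;> apply mul_left_cancel₀ hr
        · linear_combination a * h1 - b * h2
        · linear_combination b * h1 + a * h2
      · intro p hp
        simp only [mem_filter, mem_univ, true_and] at hp
        refine ⟨((a * p.1 - b * p.2) / (a ^ 2 + b ^ 2), (b * p.1 + a * p.2) / (a ^ 2 + b ^ 2)), ?_, ?_⟩
        · simp only [mem_filter, mem_univ, true_and]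
          unfold nrm
          dsimp only
          field_simp
          apply mul_left_cancel₀ hr
          linear_combination (a ^ 2 + b ^ 2) ^ 2 * hp
        · ext
          · simp only; field_simp; try ring
          · simp only; field_simp; try ring
      · intro p _; rfl
    rw [e, circle_sum hF (fun s => ψ s), hsum0, zero_add, norm_mul]
    have w := weil hF ψ hψ ((a ^ 2 + b ^ 2) * t) (mul_ne_zero hr ht)
    have := norm_quad_neg_one (F := F)
    exact (mul_le_of_le_one_left (norm_nonneg _) this).trans w

lemma exists_mulShift (ψ : AddChar F ℂ) (hψ : ψ ≠ 0) (χ : AddChar F ℂ) :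
    ∃ a, ∀ x, χ x = ψ (a * x) := by
  have hprim : ψ.IsPrimitive := AddChar.IsPrimitive.of_ne_one hψ
  have hinj : Function.Injective (fun a : F => ψ.mulShift a) := by
    exact AddChar.to_mulShift_inj_of_isPrimitive hprim
  have hbij := (Fintype.bijective_iff_injective_and_card (fun a : F => ψ.mulShift a)).2
    ⟨hinj, AddChar.card_eq.symm⟩
  obtain ⟨a, ha⟩ := hbij.2 χ
  exact ⟨a, fun x => by rw [← ha]; rfl⟩

lemma four (hF : ringChar F ≠ 2) {t : F} (ht : t ≠ 0) (χ : AddChar (F × F) ℂ) (hχ : χ ≠ 0) :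
    ‖∑ p ∈ univ.filter (fun p : F × F => nrm p = t), χ p‖ ≤ 2 * Real.sqrt (Fintype.card F) := by
  have : Nontrivial (AddChar F ℂ) := by
    rw [← Fintype.one_lt_card_iff_nontrivial, AddChar.card_eq]; exact Fintype.one_lt_card
  obtain ⟨ψ, hψ⟩ := exists_ne (0 : AddChar F ℂ)
  obtain ⟨a, ha⟩ := exists_mulShift ψ hψ (χ.compAddMonoidHom (AddMonoidHom.inl F F))
  obtain ⟨b, hb⟩ := exists_mulShift ψ hψ (χ.compAddMonoidHom (AddMonoidHom.inr F F))
  have h : ∀ p : F × F, χ p = ψ (a * p.1 + b * p.2) := by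
    intro p
    rw [AddChar.map_add_eq_mul, ← ha, ← hb]
    simp [← AddChar.map_add_eq_mul]
  simp_rw [h]
  refine four_aux hF ht ψ hψ a b ?_
  rintro ⟨rfl, rfl⟩
  apply hχ
  ext p
  rw [h]; simp

end Four
end PartP6

section PartP7
open Finset

section Fin
set_option linter.unusedSectionVars false
variable {F : Type} [Field F] [Fintype F] [DecidableEq F]

lemma parseval (A : Finset (F × F)) :
    ∑ χ : AddChar (F × F) ℂ, ‖∑ z ∈ A, χ z‖ ^ 2 = (Fintype.card F : ℝ) ^ 2 * A.card := by
  have h : ∀ χ : AddChar (F × F) ℂ, ((‖∑ z ∈ A, χ z‖ ^ 2 : ℝ) : ℂ) = ∑ z ∈ A, ∑ w ∈ A, χ (z - w) := by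
    intro χ
    rw [Complex.ofReal_pow, ← Complex.mul_conj', map_sum, sum_mul_sum]
    refine sum_congr rfl fun z _ => sum_congr rfl fun w _ => ?_
    rw [← AddChar.map_neg_eq_conj, ← AddChar.map_add_eq_mul, sub_eq_add_neg]
  apply Complex.ofReal_injective
  rw [Complex.ofReal_sum, sum_congr rfl (fun χ _ => h χ), sum_comm]
  have h2 : ∀ z ∈ A, ∑ χ : AddChar (F × F) ℂ, ∑ w ∈ A, χ (z - w) = (Fintype.card F : ℂ) ^ 2 := by
    intro z hz
    rw [sum_comm]
    simp_rw [AddChar.sum_apply_eq_ite, sub_eq_zero]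
    rw [sum_ite_eq, if_pos hz, Fintype.card_prod]
    push_cast; ring
  rw [sum_congr rfl h2, sum_const, nsmul_eq_mul]
  push_cast; ring

lemma norm_sum_neg (A : Finset (F × F)) (χ : AddChar (F × F) ℂ) :
    ‖∑ z ∈ A, χ (-z)‖ = ‖∑ z ∈ A, χ z‖ := by
  simp_rw [AddChar.map_neg_eq_conj]
  rw [← map_sum, RCLike.norm_conj]

def cnt (t : F) (A B : Finset (F × F)) : ℕ :=
  ((A ×ˢ B).filter (fun p => nrm (p.1 - p.2) = t)).card

lemma cnt_fourier (t : F) (A B : Finset (F × F)) :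
    (Fintype.card F : ℂ) ^ 2 * cnt t A B = ∑ χ : AddChar (F × F) ℂ,
      (∑ s ∈ univ.filter (fun p : F × F => nrm p = t), χ s) * (∑ x ∈ A, χ (-x)) * (∑ z ∈ B, χ z) := by
  have h : ∀ χ : AddChar (F × F) ℂ, (∑ s ∈ univ.filter (fun p : F × F => nrm p = t), χ s) *
      (∑ x ∈ A, χ (-x)) * (∑ z ∈ B, χ z) =
      ∑ x ∈ A, ∑ z ∈ B, ∑ s ∈ univ.filter (fun p : F × F => nrm p = t), χ (s - (x - z)) := by
    intro χ
    rw [mul_assoc, sum_mul_sum, mul_sum]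
    simp_rw [mul_sum, sum_mul]
    refine sum_congr rfl fun x _ => sum_congr rfl fun z _ => sum_congr rfl fun s _ => ?_
    rw [← AddChar.map_add_eq_mul, ← AddChar.map_add_eq_mul]
    congr 1; abel
  rw [sum_congr rfl (fun χ _ => h χ), sum_comm, cnt, card_filter, sum_product]
  push_cast
  rw [mul_sum]
  refine sum_congr rfl fun x _ => ?_
  rw [sum_comm, mul_sum]
  refine sum_congr rfl fun z _ => ?_
  rw [sum_comm]
  simp_rw [AddChar.sum_apply_eq_ite, sub_eq_zero]
  rw [sum_ite_eq', Fintype.card_prod]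
  simp only [mem_filter, mem_univ, true_and]
  split_ifs <;> push_cast <;> ring

lemma cnt_bound (hF : ringChar F ≠ 2) {t : F} (ht : t ≠ 0) (A B : Finset (F × F)) :
    |(cnt t A B : ℝ) - (univ.filter (fun p : F × F => nrm p = t)).card / (Fintype.card F : ℝ) ^ 2 *
      (A.card * B.card)| ≤ 2 * Real.sqrt (Fintype.card F) * (Real.sqrt A.card * Real.sqrt B.card) := by
  classical
  set q : ℝ := ((Fintype.card F : ℕ) : ℝ) with hq
  have hq0 : 0 < q := by rw [hq]; exact_mod_cast Fintype.card_pos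
  set n : ℝ := (((univ.filter (fun p : F × F => nrm p = t)).card : ℕ) : ℝ) with hn
  have h := cnt_fourier t A B
  rw [Fintype.sum_eq_add_sum_subtype_ne _ (0 : AddChar (F × F) ℂ)] at h
  simp only [AddChar.zero_apply, sum_const, nsmul_eq_mul, mul_one] at h
  have h2 : ((q ^ 2 * cnt t A B - n * (A.card * B.card) : ℝ) : ℂ) =
      ∑ χ : {χ : AddChar (F × F) ℂ // χ ≠ 0}, (∑ s ∈ univ.filter (fun p : F × F => nrm p = t), χ.1 s) *
      (∑ x ∈ A, χ.1 (-x)) * (∑ z ∈ B, χ.1 z) := by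
    rw [hq, hn]
    push_cast
    linear_combination h
  have h3 : |q ^ 2 * cnt t A B - n * (A.card * B.card)| ≤
      ∑ χ : {χ : AddChar (F × F) ℂ // χ ≠ 0}, 2 * Real.sqrt q * (‖∑ z ∈ A, χ.1 z‖ * ‖∑ z ∈ B, χ.1 z‖) := by
    rw [← Real.norm_eq_abs, ← Complex.norm_real, h2]
    refine (norm_sum_le _ _).trans (sum_le_sum fun χ _ => ?_)
    rw [norm_mul, norm_mul, norm_sum_neg, mul_assoc]
    gcongr
    exact four hF ht χ.1 χ.2
  have h4 : ∑ χ : {χ : AddChar (F × F) ℂ // χ ≠ 0}, 2 * Real.sqrt q * (‖∑ z ∈ A, χ.1 z‖ * ‖∑ z ∈ B, χ.1 z‖)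
      ≤ ∑ χ : AddChar (F × F) ℂ, 2 * Real.sqrt q * (‖∑ z ∈ A, χ z‖ * ‖∑ z ∈ B, χ z‖) := by
    rw [Fintype.sum_eq_add_sum_subtype_ne _ (0 : AddChar (F × F) ℂ)]
    exact le_add_of_nonneg_left (by positivity)
  have h5 := Real.sum_mul_le_sqrt_mul_sqrt univ (fun χ : AddChar (F × F) ℂ => ‖∑ z ∈ A, χ z‖)
    (fun χ => ‖∑ z ∈ B, χ z‖)
  rw [parseval, parseval, ← hq, Real.sqrt_mul (by positivity), Real.sqrt_mul (by positivity),
    Real.sqrt_sq hq0.le] at h5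
  have h6 : |q ^ 2 * cnt t A B - n * (A.card * B.card)| ≤
      q ^ 2 * (2 * Real.sqrt q * (Real.sqrt A.card * Real.sqrt B.card)) := by
    refine (h3.trans h4).trans ?_
    rw [← mul_sum]
    calc _ ≤ 2 * Real.sqrt q * (q * √A.card * (q * √B.card)) := by gcongr
      _ = _ := by ring
  have e : q ^ 2 * cnt t A B - n * (A.card * B.card) =
      q ^ 2 * (cnt t A B - n / q ^ 2 * (A.card * B.card)) := by field_simp
  rw [e, abs_mul, abs_of_pos (by positivity)] at h6
  exact le_of_mul_le_mul_left h6 (by positivity)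

def fibr (A B : Finset (F × F)) (u : F × F) : Finset (F × F) := A.filter (fun x => x - u ∈ B)

lemma cnt_eq (t : F) (A B : Finset (F × F)) :
    cnt t A B = ∑ u ∈ univ.filter (fun p : F × F => nrm p = t), (fibr A B u).card := by
  rw [cnt, card_eq_sum_card_fiberwise (f := fun p => p.1 - p.2)
    (t := univ.filter (fun p : F × F => nrm p = t))]
  · refine sum_congr rfl fun u hu => ?_
    refine card_bij (fun p _ => p.1) ?_ ?_ ?_
    · intro p hp
      simp only [mem_filter, mem_product] at hp
      rw [fibr, mem_filter, ← hp.2]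
      exact ⟨hp.1.1.1, by simpa using hp.1.1.2⟩
    · intro p hp r hr h
      simp only [mem_filter] at hp hr
      ext1
      · exact h
      · have := hp.2.trans hr.2.symm
        rw [h] at this
        exact sub_right_injective this
    · intro x hx
      rw [fibr, mem_filter] at hx
      refine ⟨(x, x - u), ?_, rfl⟩
      simp only [mem_filter, mem_product, mem_univ, true_and] at hu ⊢
      simp [hx, hu]
  · intro p hp
    simpa using (mem_filter.1 hp).2

lemma par_eq (t : F) (E1 E2 E3 E4 : Finset (F × F)) :
    parT t E1 E2 E3 E4 = ∑ u ∈ univ.filter (fun p : F × F => nrm p = t),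
      (fibr E1 E2 u).card * (fibr E3 E4 u).card := by
  rw [parT, card_eq_sum_card_fiberwise (f := fun p => p.1.1 - p.1.2)
    (t := univ.filter (fun p : F × F => nrm p = t))]
  · refine sum_congr rfl fun u hu => ?_
    rw [← card_product]
    refine card_bij (fun p _ => (p.1.1, p.2.1)) ?_ ?_ ?_
    · intro p hp
      simp only [mem_filter, mem_product] at hp
      rw [mem_product, fibr, fibr, mem_filter, mem_filter]
      refine ⟨⟨hp.1.1.1.1, ?_⟩, hp.1.1.2.1, ?_⟩
      · rw [← hp.2]; simpa using hp.1.1.1.2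
      · rw [← hp.2, hp.1.2.1]; simpa using hp.1.1.2.2
    · intro p hp r hr h
      simp only [mem_filter] at hp hr
      have h1 := (Prod.mk.inj h).1
      have h2 := (Prod.mk.inj h).2
      have h3 := hp.2.trans hr.2.symm
      have h4 := (hp.1.2.1.symm.trans h3).trans hr.1.2.1
      rw [h1] at h3
      rw [h2] at h4
      exact Prod.ext (Prod.ext h1 (sub_right_injective h3)) (Prod.ext h2 (sub_right_injective h4))
    · intro x hx
      rw [mem_product, fibr, fibr, mem_filter, mem_filter] at hx
      refine ⟨((x.1, x.1 - u), (x.2, x.2 - u)), ?_, rfl⟩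
      simp only [mem_filter, mem_product, mem_univ, true_and] at hu ⊢
      simp [hx, hu]
  · intro p hp
    simpa using (mem_filter.1 hp).2.2

lemma rhom_eq (t : F) (E1 E2 E3 E4 : Finset (F × F)) :
    rhomT t E1 E2 E3 E4 = ∑ u ∈ univ.filter (fun p : F × F => nrm p = t),
      cnt t (fibr E1 E2 u) (fibr E3 E4 u) := by
  rw [rhomT, card_eq_sum_card_fiberwise (f := fun p => p.1.1 - p.1.2)
    (t := univ.filter (fun p : F × F => nrm p = t))]
  · refine sum_congr rfl fun u hu => ?_
    rw [cnt]
    refine card_bij (fun p _ => (p.1.1, p.2.1)) ?_ ?_ ?_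
    · intro p hp
      simp only [mem_filter, mem_product] at hp
      rw [mem_filter, mem_product, fibr, fibr, mem_filter, mem_filter]
      refine ⟨⟨⟨hp.1.1.1.1, ?_⟩, hp.1.1.2.1, ?_⟩, hp.1.2.2.2⟩
      · rw [← hp.2]; simpa using hp.1.1.1.2
      · rw [← hp.2, hp.1.2.1]; simpa using hp.1.1.2.2
    · intro p hp r hr h
      simp only [mem_filter] at hp hr
      have h1 := (Prod.mk.inj h).1
      have h2 := (Prod.mk.inj h).2
      have h3 := hp.2.trans hr.2.symm
      have h4 := (hp.1.2.1.symm.trans h3).trans hr.1.2.1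
      rw [h1] at h3
      rw [h2] at h4
      exact Prod.ext (Prod.ext h1 (sub_right_injective h3)) (Prod.ext h2 (sub_right_injective h4))
    · intro x hx
      rw [mem_filter, mem_product, fibr, fibr, mem_filter, mem_filter] at hx
      refine ⟨((x.1, x.1 - u), (x.2, x.2 - u)), ?_, rfl⟩
      simp only [mem_filter, mem_product, mem_univ, true_and] at hu ⊢
      simp [hx, hu]
  · intro p hp
    simpa using (mem_filter.1 hp).2.2.1

lemma cnt_le (hF : ringChar F ≠ 2) {t : F} (ht : t ≠ 0) (A B : Finset (F × F))
    (h : (Fintype.card F : ℝ) ^ 3 ≤ (A.card : ℝ) * B.card) :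
    (cnt t A B : ℝ) ≤ 4 * ((A.card : ℝ) * B.card / Fintype.card F) := by
  have h1 := cnt_bound hF ht A B
  have h2 := circle_card hF ht
  set q : ℝ := ((Fintype.card F : ℕ) : ℝ) with hq
  have hq1 : 1 ≤ q := by rw [hq]; exact_mod_cast Fintype.card_pos
  set n : ℝ := (((univ.filter (fun p : F × F => nrm p = t)).card : ℕ) : ℝ) with hn
  rw [← Real.sqrt_mul (by positivity), mul_assoc, ← Real.sqrt_mul (by positivity)] at h1
  set e : ℝ := (A.card : ℝ) * B.card with he
  have he0 : 0 ≤ e := by positivity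
  have h3 : Real.sqrt (q * e) ≤ e / q := by
    rw [Real.sqrt_le_left (by positivity), div_pow, le_div_iff₀ (by positivity)]
    nlinarith
  have h4 : n ≤ 2 * q := by
    have := (abs_le.1 h2).2; linarith
  have h5 : n / q ^ 2 * e ≤ 2 * (e / q) := by
    calc n / q ^ 2 * e ≤ 2 * q / q ^ 2 * e := by gcongr
      _ = 2 * (e / q) := by field_simp
  have := (abs_le.1 h1).2
  linarith

set_option maxHeartbeats 1000000 in
lemma main_bound (hF : ringChar F ≠ 2) {t : F} (ht : t ≠ 0) (E1 E2 E3 E4 : Finset (F × F))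
    (h12 : (Fintype.card F : ℝ) ^ 3 ≤ (E1.card : ℝ) * E2.card)
    (h34 : (Fintype.card F : ℝ) ^ 3 ≤ (E3.card : ℝ) * E4.card) :
    |(rhomT t E1 E2 E3 E4 : ℝ) - (parT t E1 E2 E3 E4 : ℝ) / (Fintype.card F : ℝ)| ≤
            12 * Real.sqrt (Fintype.card F) *
              Real.sqrt ((E1.card : ℝ) * E2.card / (Fintype.card F : ℝ)) *
              Real.sqrt ((E3.card : ℝ) * E4.card / (Fintype.card F : ℝ)) := by
  have hA := cnt_le hF ht E1 E2 h12
  have hB := cnt_le hF ht E3 E4 h34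
  have h2 := circle_card hF ht
  have hcb := fun u => cnt_bound hF ht (fibr E1 E2 u) (fibr E3 E4 u)
  have hcard : ∀ A : Finset (F × F), (A.card : ℝ) ≤ (Fintype.card F : ℝ) ^ 2 := by
    intro A
    have := A.card_le_univ
    rw [Fintype.card_prod, ← pow_two] at this
    exact_mod_cast this
  rw [rhom_eq, par_eq]
  rw [cnt_eq] at hA hB
  push_cast at hA hB ⊢
  set q : ℝ := ((Fintype.card F : ℕ) : ℝ) with hq
  have hq1 : 1 ≤ q := by rw [hq]; exact_mod_cast Fintype.card_pos
  set S := univ.filter (fun p : F × F => nrm p = t) with hS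
  set n : ℝ := (S.card : ℝ) with hn
  set a : F × F → ℝ := fun u => ((fibr E1 E2 u).card : ℝ) with ha
  set b : F × F → ℝ := fun u => ((fibr E3 E4 u).card : ℝ) with hb
  have hsq1 : 1 ≤ √q := Real.one_le_sqrt.2 hq1
  have hterm : ∀ u, |(cnt t (fibr E1 E2 u) (fibr E3 E4 u) : ℝ) - a u * b u / q| ≤
      3 * √q * (√(a u) * √(b u)) := by
    intro u
    have h1 := hcb u
    change |(cnt t (fibr E1 E2 u) (fibr E3 E4 u) : ℝ) - n / q ^ 2 * (a u * b u)| ≤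
      2 * √q * (√(a u) * √(b u)) at h1
    have ha0 : 0 ≤ a u := by positivity
    have hb0 : 0 ≤ b u := by positivity
    have ha1 : √(a u) ≤ q := by rw [Real.sqrt_le_left (by positivity)]; exact hcard _
    have hb1 : √(b u) ≤ q := by rw [Real.sqrt_le_left (by positivity)]; exact hcard _
    have h3 : |n / q ^ 2 * (a u * b u) - a u * b u / q| ≤ √q * (√(a u) * √(b u)) := by
      have e : n / q ^ 2 * (a u * b u) - a u * b u / q = (n - q) * (a u * b u / q ^ 2) := by
        field_simp
      rw [e, abs_mul, abs_of_nonneg (by positivity : 0 ≤ a u * b u / q ^ 2)]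
      have h5 : a u * b u / q ^ 2 ≤ √(a u) * √(b u) := by
        rw [div_le_iff₀ (by positivity)]
        calc a u * b u = (√(a u) * √(b u)) * (√(a u) * √(b u)) := by
              rw [mul_mul_mul_comm, Real.mul_self_sqrt ha0, Real.mul_self_sqrt hb0]
          _ ≤ (√(a u) * √(b u)) * (q * q) := by gcongr
          _ = _ := by ring
      calc |n - q| * (a u * b u / q ^ 2) ≤ 1 * (√(a u) * √(b u)) := by gcongr
        _ ≤ √q * (√(a u) * √(b u)) := by gcongr
    have := abs_sub_le (cnt t (fibr E1 E2 u) (fibr E3 E4 u) : ℝ) (n / q ^ 2 * (a u * b u)) (a u * b u / q)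
    linarith
  rw [sum_div, ← sum_sub_distrib]
  refine (abs_sum_le_sum_abs _ _).trans ((sum_le_sum fun u _ => hterm u).trans ?_)
  rw [← mul_sum]
  have hcs := Real.sum_mul_le_sqrt_mul_sqrt S (fun u => √(a u)) (fun u => √(b u))
  rw [sum_congr rfl (fun u _ => Real.sq_sqrt (show 0 ≤ a u by positivity)),
    sum_congr rfl (fun u _ => Real.sq_sqrt (show 0 ≤ b u by positivity))] at hcs
  have h4 : √(4:ℝ) = 2 := by rw [show (4:ℝ) = 2 ^ 2 by norm_num, Real.sqrt_sq (by norm_num)]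
  have hA' := Real.sqrt_le_sqrt hA
  have hB' := Real.sqrt_le_sqrt hB
  rw [Real.sqrt_mul (by norm_num), h4] at hA' hB'
  have hm : √(∑ u ∈ S, a u) * √(∑ u ∈ S, b u) ≤
      (2 * √((E1.card : ℝ) * E2.card / q)) * (2 * √((E3.card : ℝ) * E4.card / q)) :=
    mul_le_mul hA' hB' (Real.sqrt_nonneg _) (by positivity)
  refine (mul_le_mul_of_nonneg_left (hcs.trans hm) (by positivity)).trans (le_of_eq ?_)
  ring
end Fin
end PartP7

theorem rhom_close_to_parT_div_q :
    ∃ C K : ℝ, 0 < C ∧ 0 < K ∧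
      ∀ (F : Type) [Field F] [Fintype F] [DecidableEq F],
        Odd (Fintype.card F) →
        ∀ t : F, t ≠ 0 →
        ∀ E1 E2 E3 E4 : Finset (F × F),
          C * (Fintype.card F : ℝ) ^ 3 ≤ (E1.card : ℝ) * E2.card →
          C * (Fintype.card F : ℝ) ^ 3 ≤ (E3.card : ℝ) * E4.card →
          |(rhomT t E1 E2 E3 E4 : ℝ) -
              (parT t E1 E2 E3 E4 : ℝ) / (Fintype.card F : ℝ)| ≤
            K * Real.sqrt (Fintype.card F) *
              Real.sqrt ((E1.card : ℝ) * E2.card / (Fintype.card F : ℝ)) *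
              Real.sqrt ((E3.card : ℝ) * E4.card / (Fintype.card F : ℝ)) := by
  refine ⟨1, 12, one_pos, by norm_num, ?_⟩
  intro F _ _ _ hodd t ht E1 E2 E3 E4 h12 h34
  rw [one_mul] at h12 h34
  have hF : ringChar F ≠ 2 := by
    intro h
    have := FiniteField.even_card_of_char_two h
    rw [Nat.odd_iff] at hodd
    omega
  exact main_bound hF ht E1 E2 E3 E4 h12 h34
end

section
/- Let F_q be a finite field of odd order q, let t ∈ F_q with t ≠ 0, and let E1, E2, E3, E4 ⊆ F_q^2. Then |Par_t(E1,E2,E3,E4) − Par(E1,E2,E3,E4)/q| ≤ 2 q^{1/2} (|E1||E2||E3||E4|)^{1/2}. -/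
open Finset

/-- `Par(E₁,E₂,E₃,E₄)`: number of quadruples `(x,y,z,w) ∈ E₁×E₂×E₃×E₄` with
`x - y = z - w`. -/
def parAll {F : Type} [Field F] [DecidableEq F]
    (E1 E2 E3 E4 : Finset (F × F)) : ℕ :=
  (((E1 ×ˢ E2) ×ˢ E3 ×ˢ E4).filter
    (fun p => p.1.1 - p.1.2 = p.2.1 - p.2.2)).card


open Polynomial in
lemma stp_coeffBound_mul {L : Type} [Field L] {A B : L[X][X]} {d e : ℕ}
    (hA : ∀ k, (A.coeff k).natDegree ≤ d) (hB : ∀ k, (B.coeff k).natDegree ≤ e) :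
    ∀ k, ((A * B).coeff k).natDegree ≤ d + e := by
  intro k
  rw [coeff_mul]
  apply natDegree_sum_le_of_forall_le
  intro i _
  exact natDegree_mul_le.trans (add_le_add (hA _) (hB _))

open Polynomial in
lemma stp_eval_inj {L : Type} [Field L] {W : L[X][X]} {s : ℕ}
    (hW : ∀ k, (W.coeff k).natDegree < s) (h0 : W.eval (X ^ s : L[X]) = 0) : W = 0 := by
  ext k r
  by_cases hr : r < s
  · have h1 := congrArg (fun P => P.coeff (s * k + r)) h0
    simp only [eval_eq_sum, sum_def, finsetSum_coeff, coeff_zero, ← pow_mul,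
      coeff_mul_X_pow'] at h1
    rw [Finset.sum_eq_single k] at h1
    · simpa using h1
    · intro k' _ hk
      split_ifs with hle
      · apply coeff_eq_zero_of_natDegree_lt
        have := hW k'
        have hlt : k' < k := by
          by_contra hc
          have : k + 1 ≤ k' := by omega
          have := Nat.mul_le_mul_left s this
          rw [Nat.mul_add] at this
          omega
        have h2 := Nat.mul_le_mul_left s (show k' + 1 ≤ k from hlt)
        rw [Nat.mul_add] at h2
        omega
      · rfl
    · intro hk
      simp [notMem_support_iff.1 hk]
  · have := hW k
    simp [coeff_eq_zero_of_natDegree_lt (show (W.coeff k).natDegree < r by omega)]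

open Polynomial in
/-- the bivariate polynomial with coefficients `c` -/
noncomputable def stpPoly {L : Type} [Field L] {m l : ℕ} (c : Fin m × Fin l → L) : L[X][X] :=
  ∑ i : Fin m × Fin l, C (C (c i) * X ^ (i.2 : ℕ)) * X ^ (i.1 : ℕ)

open Polynomial in
lemma stpPoly_coeff {L : Type} [Field L] {m l : ℕ} (c : Fin m × Fin l → L) (j : Fin m) (i : Fin l) :
    ((stpPoly c).coeff j).coeff i = c (j, i) := by
  simp only [stpPoly, finsetSum_coeff, coeff_C_mul_X_pow]
  rw [Finset.sum_eq_single (j, i)]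
  · simp
  · rintro ⟨j', i'⟩ _ hne
    dsimp only
    split_ifs with h
    · rw [coeff_C_mul_X_pow, if_neg]
      intro h2
      exact hne (Prod.ext (Fin.ext h.symm) (Fin.ext h2.symm))
    · simp
  · simp

open Polynomial in
lemma stpPoly_deg {L : Type} [Field L] {m l : ℕ} (c : Fin m × Fin l → L) (k : ℕ) :
    ((stpPoly c).coeff k).natDegree ≤ l - 1 := by
  simp only [stpPoly, finsetSum_coeff, coeff_C_mul_X_pow]
  apply natDegree_sum_le_of_forall_le
  intro i _
  split_ifs
  · refine (natDegree_C_mul_X_pow_le _ _).trans ?_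
    have := i.2.2
    omega
  · simp

open Polynomial in
lemma stp_main {L : Type} [Field L] [Fintype L] [DecidableEq L] (p : ℕ) [Fact p.Prime] [CharP L p]
    (e s σ q : ℕ) (hs : s = p ^ e) (hsσ : s = 2 * σ + 1) (hcard : Fintype.card L = s ^ 2)
    (hσ : q ^ 2 + q < σ) (h : L[X]) (hm : h.Monic) (hdeg : h.natDegree = 2 * q)
    (hns : ∀ a b : L[X], a ^ 2 * h = b ^ 2 → a = 0) (ε : L) (hε : ε ≠ 0) :
    2 * (univ.filter (fun y : L => (h.eval y) ^ (σ * (s + 1)) = ε)).card ≤ s ^ 2 + 4 * q * s := by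
  have hqσ : q < σ := by nlinarith [Nat.zero_le (q^2)]
  obtain ⟨l, hl⟩ : ∃ l, σ = l + q + 1 := ⟨σ - q - 1, by omega⟩
  set m := σ + q + 1 with hmdef
  let ι := (Fin m × Fin (l+1)) ⊕ (Fin m × Fin (l+1))
  set E := l * s + 2 * q * σ + m with hE
  have hF : ∀ y : L, y ^ (s ^ 2) = y := fun y => by rw [← hcard]; exact FiniteField.pow_card y
  let v : ι → L[X] := Sum.elim (fun i => X ^ ((i.2 : ℕ) * s + i.1) * h ^ σ)
    (fun i => C ε * X ^ ((i.2 : ℕ) * s + i.1))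
  have hv : ∀ i, v i ∈ degreeLT L E := by
    have hb : ∀ i : Fin m × Fin (l+1), (i.2 : ℕ) * s + i.1 < l * s + m := by
      intro i
      have h1 := i.1.2
      have h2 : (i.2 : ℕ) ≤ l := by have := i.2.2; omega
      have := Nat.mul_le_mul_right s h2
      omega
    rintro (i | i)
    · rw [mem_degreeLT]
      refine lt_of_le_of_lt degree_le_natDegree ?_
      have : (X ^ ((i.2 : ℕ) * s + i.1) * h ^ σ : L[X]).natDegree ≤ (i.2 : ℕ) * s + i.1 + σ * (2 * q) := by
        refine natDegree_mul_le.trans (add_le_add (by simp) ?_)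
        rw [← hdeg]; exact natDegree_pow_le
      have := hb i
      have : σ * (2 * q) = 2 * q * σ := by ring
      norm_cast
      simp only [v, Sum.elim_inl]
      omega
    · rw [mem_degreeLT]
      refine lt_of_le_of_lt degree_le_natDegree ?_
      have : (C ε * X ^ ((i.2 : ℕ) * s + i.1) : L[X]).natDegree ≤ (i.2 : ℕ) * s + i.1 :=
        natDegree_C_mul_X_pow_le _ _
      have := hb i
      norm_cast
      simp only [v, Sum.elim_inr]
      omega
  have hnli : ¬ LinearIndependent L v := by
    intro hli
    have hli2 : LinearIndependent L (fun i => (⟨v i, hv i⟩ : degreeLT L E)) := by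
      apply LinearIndependent.of_comp (degreeLT L E).subtype
      exact hli
    have : Module.Finite L (degreeLT L E) := Module.Finite.equiv (degreeLTEquiv L E).symm
    have h1 := hli2.fintype_card_le_finrank
    rw [(degreeLTEquiv L E).finrank_eq] at h1
    simp only [ι, Fintype.card_sum, Fintype.card_prod, Fintype.card_fin, Module.finrank_fin_fun] at h1
    rw [hE, hmdef, hsσ] at h1
    subst hl
    nlinarith
  rw [Fintype.not_linearIndependent_iff] at hnli
  obtain ⟨g, hg, i0, hi0⟩ := hnli
  let c : ι → L := fun i => g i ^ s
  have hc : ∀ i, c i ^ s = g i := fun i => by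
    simp only [c]; rw [← pow_mul, ← sq]; exact hF _
  set A : L[X][X] := stpPoly (fun i => c (Sum.inl i)) with hA
  set B : L[X][X] := stpPoly (fun i => c (Sum.inr i)) with hB
  have hs0 : s ≠ 0 := by omega
  have hevA : ∀ c' : Fin m × Fin (l+1) → L, (stpPoly c').eval (X ^ s : L[X]) =
      ∑ i, C (c' i) * X ^ (i.2 : ℕ) * X ^ (s * (i.1 : ℕ)) := by
    intro c'
    simp [stpPoly, eval_finsetSum, ← pow_mul]
  set G : L[X] := A.eval (X ^ s) + B.eval (X ^ s) * h ^ σ with hG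
  have hG0 : G ≠ 0 := by
    intro h0
    have hAB : A.eval (X ^ s : L[X]) = - (B.eval (X ^ s) * h ^ σ) := eq_neg_of_add_eq_zero_left h0
    set H : L[X][X] := (h.map (iterateFrobenius L p e)).map C with hH
    have hHev : H.eval (X ^ s : L[X]) = h ^ s := by
      rw [hH, eval_map, hs, ← map_iterateFrobenius_expand p h e, expand_eq_comp_X_pow, Polynomial.map_comp,
        Polynomial.map_pow, Polynomial.map_X]
      rfl
    have hHm : H.Monic := (hm.map _).map _
    have hW : (A ^ 2 * C h - B ^ 2 * H).eval (X ^ s : L[X]) = 0 := by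
      rw [eval_sub, eval_mul, eval_mul, eval_pow, eval_pow, eval_C, hHev, hAB, hsσ]
      ring
    have hdA := stpPoly_deg (fun i => c (Sum.inl i))
    have hdB := stpPoly_deg (fun i => c (Sum.inr i))
    rw [← hA] at hdA
    rw [← hB] at hdB
    have hW0 := stp_eval_inj (s := s) (W := A ^ 2 * C h - B ^ 2 * H) (by
      intro k
      have h1 := stp_coeffBound_mul (stp_coeffBound_mul hdA hdA) (B := C h) (e := 2 * q) (by
        intro k
        rw [coeff_C]
        split_ifs
        · omega
        · simp) k
      have h2 := stp_coeffBound_mul (stp_coeffBound_mul hdB hdB) (B := H) (e := 0) (by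
        intro k
        rw [hH, coeff_map]
        simp) k
      rw [coeff_sub, sq, sq]
      refine lt_of_le_of_lt (natDegree_sub_le _ _) (max_lt ?_ ?_) <;> omega) hW
    have hAB2 := sub_eq_zero.1 hW0
    have hlc := congrArg leadingCoeff hAB2
    rw [leadingCoeff_mul, leadingCoeff_mul, leadingCoeff_pow, leadingCoeff_pow, leadingCoeff_C,
      hHm.leadingCoeff, mul_one] at hlc
    have hA0 : A = 0 := leadingCoeff_eq_zero.1 (hns _ _ hlc)
    have hB0 : B = 0 := by
      rw [hA0] at hAB2
      have : B ^ 2 * H = 0 := by rw [← hAB2]; simp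
      rcases mul_eq_zero.1 this with h | h
      · exact pow_eq_zero_iff (two_ne_zero) |>.1 h
      · exact absurd h hHm.ne_zero
    have hci : c i0 = 0 := by
      rcases i0 with ⟨j, i⟩ | ⟨j, i⟩
      · rw [← stpPoly_coeff (fun i => c (Sum.inl i)), ← hA, hA0]; simp
      · rw [← stpPoly_coeff (fun i => c (Sum.inr i)), ← hB, hB0]; simp
    exact hi0 (by rw [← hc, hci, zero_pow hs0])
  have hGdeg : G.natDegree ≤ l + s * (m - 1) + 2 * q * σ := by
    have hd : ∀ c' : Fin m × Fin (l+1) → L, ((stpPoly c').eval (X ^ s : L[X])).natDegree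
        ≤ l + s * (m - 1) := by
      intro c'
      rw [hevA]
      apply natDegree_sum_le_of_forall_le
      intro i _
      refine natDegree_mul_le.trans (add_le_add ((natDegree_C_mul_X_pow_le _ _).trans ?_) ?_)
      · have := i.2.2; omega
      · rw [natDegree_X_pow]
        apply Nat.mul_le_mul_left
        have := i.1.2
        omega
    refine (natDegree_add_le _ _).trans (max_le ((hd _).trans (by omega)) ?_)
    refine natDegree_mul_le.trans (add_le_add (hd _) ?_)
    refine natDegree_pow_le.trans ?_
    rw [hdeg]; apply le_of_eq; ring
  have hroot : ∀ y : L, (h.eval y) ^ (σ * (s + 1)) = ε → G.eval y = 0 := by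
    intro y hy
    have hy0 : h.eval y ≠ 0 := by
      intro h0
      rw [h0, zero_pow (by have : 0 < σ := by omega
                           positivity)] at hy
      exact hε hy.symm
    have hrel := congrArg (fun P => P.eval y) hg
    have hfrob : ∀ (κ : Type) (_ : Fintype κ) (f : κ → L), (∑ i, f i) ^ s = ∑ i, f i ^ s := by
      intro κ _ f
      rw [hs]
      exact sum_pow_char_pow p e _ _
    have hfrob2 : ∀ x y : L, (x + y) ^ s = x ^ s + y ^ s := by
      intro x y; rw [hs]; exact add_pow_char_pow x y p e
    have key : (h.eval y) ^ σ * (G.eval y) ^ s = 0 := by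
      rw [← eval_zero (x := y), ← hrel, hG, hA, hB, hevA, hevA]
      simp only [eval_add, eval_mul, eval_pow, eval_finsetSum, eval_C, eval_X, v, ι,
        Fintype.sum_sum_type, eval_smul, Sum.elim_inl, Sum.elim_inr, smul_eq_mul, hfrob2, hfrob _ _ _,
        mul_pow, hc, mul_add, Finset.mul_sum, Finset.sum_mul]
      congr 1
      · apply Finset.sum_congr rfl
        intro i _
        have : (y ^ (s * (i.1 : ℕ))) ^ s = y ^ (i.1 : ℕ) := by
          rw [← pow_mul, show s * (i.1 : ℕ) * s = s ^ 2 * i.1 by ring, pow_mul, hF]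
        rw [this]
        ring
      · apply Finset.sum_congr rfl
        intro i _
        have : (y ^ (s * (i.1 : ℕ))) ^ s = y ^ (i.1 : ℕ) := by
          rw [← pow_mul, show s * (i.1 : ℕ) * s = s ^ 2 * i.1 by ring, pow_mul, hF]
        rw [this, ← hy]
        ring
    rcases mul_eq_zero.1 key with h1 | h1
    · exact absurd h1 (pow_ne_zero _ hy0)
    · exact (pow_eq_zero_iff hs0).1 h1
  have hcount : (univ.filter (fun y : L => (h.eval y) ^ (σ * (s + 1)) = ε)).card ≤ G.natDegree := by
    refine le_trans ?_ (card_roots' G)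
    refine le_trans ?_ (Multiset.toFinset_card_le _)
    apply Finset.card_le_card
    intro y hy
    simp only [mem_filter, mem_univ, true_and] at hy
    simp [hG0, hroot y hy]
  have hfin := hcount.trans hGdeg
  have hm1 : m - 1 = σ + q := by omega
  rw [hm1, hsσ] at hfin
  rw [hsσ]
  subst hl
  nlinarith

open Polynomial in
lemma stp_nonsq {L : Type} [Field L] {h : L[X]} (hsep : h.Separable) (hd : 0 < h.natDegree)
    (a b : L[X]) (hab : a ^ 2 * h = b ^ 2) : a = 0 := by
  by_contra ha
  have h1 : a ∣ b := by
    rw [← IsIntegrallyClosed.pow_dvd_pow_iff (two_ne_zero)]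
    exact ⟨h, hab.symm⟩
  obtain ⟨c, rfl⟩ := h1
  have h2 : h = c * c := by
    have : a ^ 2 * h = a ^ 2 * (c * c) := by rw [hab]; ring
    exact mul_left_cancel₀ (pow_ne_zero 2 ha) this
  have h3 := hsep.squarefree c ⟨1, by rw [h2]; ring⟩
  have h4 := natDegree_eq_zero_of_isUnit h3
  have h5 := natDegree_mul_le (p := c) (q := c)
  rw [h2] at hd
  omega

open Polynomial in
/-- the hyperelliptic polynomial -/
noncomputable def stpH {L : Type} [Field L] (q : ℕ) (γ D : L) : L[X] :=
  (X ^ q - X + C γ) ^ 2 - C D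

open Polynomial in
lemma stpH_monic {L : Type} [Field L] (q : ℕ) (hq : 2 ≤ q) (γ D : L) :
    (stpH q γ D).Monic ∧ (stpH q γ D).natDegree = 2 * q := by
  have h1 : (X ^ q - X + C γ : L[X]) = X ^ q + (- X + C γ) := by ring
  have hd1 : (- X + C γ : L[X]).degree < q := by
    refine lt_of_le_of_lt (degree_add_le _ _) (max_lt ?_ ?_)
    · rw [degree_neg, degree_X]; exact_mod_cast hq
    · exact lt_of_le_of_lt degree_C_le (by exact_mod_cast (by omega : 0 < q))
  have hm1 : (X ^ q - X + C γ : L[X]).Monic := by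
    rw [h1]; exact monic_X_pow_add hd1
  have hn1 : (X ^ q - X + C γ : L[X]).natDegree = q := by
    rw [h1]
    apply natDegree_eq_of_degree_eq_some
    rw [degree_add_eq_left_of_degree_lt (by rwa [degree_X_pow]), degree_X_pow]
  have hm2 := hm1.pow 2
  have hn2 : ((X ^ q - X + C γ : L[X]) ^ 2).natDegree = 2 * q := by
    rw [hm1.natDegree_pow, hn1]
  have hlt : (C D).degree < ((X ^ q - X + C γ : L[X]) ^ 2).degree := by
    refine lt_of_le_of_lt degree_C_le ?_
    rw [degree_eq_natDegree hm2.ne_zero, hn2]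
    exact_mod_cast (by omega : 0 < 2 * q)
  refine ⟨hm2.sub_of_left hlt, ?_⟩
  rw [stpH, natDegree_sub_eq_left_of_natDegree_lt, hn2]
  rw [natDegree_C, hn2]; omega

open Polynomial in
lemma stpH_sep {L : Type} [Field L] (q : ℕ) (hq : (q : L) = 0) (h2 : (2 : L) ≠ 0) (γ D : L)
    (hD : D ≠ 0) : (stpH q γ D).Separable := by
  have hder : derivative (stpH q γ D) = - 2 * (X ^ q - X + C γ) := by
    simp [stpH, derivative_pow, hq]
    left; rfl
  refine ⟨C (-D⁻¹), C (-D⁻¹ * 2⁻¹) * (X ^ q - X + C γ), ?_⟩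
  rw [hder, stpH]
  have e1 : (C (-D⁻¹) * C D : L[X]) = -1 := by
    rw [← C_mul]; simp [hD]
  have e2 : (C (-D⁻¹ * 2⁻¹) * 2 : L[X]) = C (-D⁻¹) := by
    rw [show (2 : L[X]) = C 2 from rfl, ← C_mul]; congr 1; field_simp
  linear_combination -e1 - (X ^ q - X + C γ) ^ 2 * e2

open Polynomial in
lemma stp_charsum {L : Type} [Field L] [Fintype L] [DecidableEq L] (p : ℕ) [Fact p.Prime] [CharP L p]
    (hp2 : p ≠ 2)
    (e s q : ℕ) (hs : s = p ^ e) (hso : Odd s) (hcard : Fintype.card L = s ^ 2)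
    (hq2 : 2 ≤ q) (hqL : (q : L) = 0)
    (hσ : 2 * (q ^ 2 + q) + 1 < s) (γ D : L) (hD : D ≠ 0) :
    |∑ y : L, quadraticChar L ((y ^ q - y + γ) ^ 2 - D)| ≤ 6 * q * s := by
  obtain ⟨σ, hsσ⟩ := hso
  have hrc : ringChar L ≠ 2 := by rw [ringChar.eq L p]; exact hp2
  have h2 : (2 : L) ≠ 0 := Ring.two_ne_zero hrc
  obtain ⟨hm, hdeg⟩ := stpH_monic q hq2 γ D
  have hns := stp_nonsq (stpH_sep q hqL h2 γ D hD) (by omega)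
  have hev : ∀ y, (stpH q γ D).eval y = (y ^ q - y + γ) ^ 2 - D := by intro y; simp [stpH]
  simp_rw [← hev]
  set h := stpH q γ D
  have hN := stp_main p e s σ q hs hsσ hcard (by omega) h hm hdeg hns
  have hhalf : Fintype.card L / 2 = σ * (s + 1) := by
    rw [hcard, hsσ, show (2 * σ + 1) ^ 2 = 1 + 2 * (σ * (2 * σ + 1 + 1)) by ring]
    omega
  have hpow : ∀ x : L, ((quadraticChar L x : ℤ) : L) = x ^ (σ * (s + 1)) := by
    intro x; rw [← hhalf]; exact quadraticChar_eq_pow_of_char_ne_two' hrc x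
  set Np := univ.filter (fun y : L => (h.eval y) ^ (σ * (s + 1)) = 1)
  set Nm := univ.filter (fun y : L => (h.eval y) ^ (σ * (s + 1)) = -1)
  set N0 := univ.filter (fun y : L => h.eval y = 0)
  have hNp := hN 1 one_ne_zero
  have hNm := hN (-1) (neg_ne_zero.2 one_ne_zero)
  have hN0 : N0.card ≤ 2 * q := by
    rw [← hdeg]
    refine le_trans ?_ (card_roots' h)
    refine le_trans ?_ (Multiset.toFinset_card_le _)
    apply Finset.card_le_card
    intro y hy
    simp only [N0, mem_filter, mem_univ, true_and] at hy
    simp [hm.ne_zero, hy]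
  have hcardL : ∑ y : L, (1 : ℤ) = (s : ℤ) ^ 2 := by
    simp [hcard]
  have up : ∑ y : L, quadraticChar L (h.eval y) ≤ 2 * (Np.card : ℤ) - s ^ 2 + N0.card := by
    rw [← hcardL, Finset.card_filter, Finset.card_filter]
    push_cast
    rw [Finset.mul_sum, ← Finset.sum_sub_distrib, ← Finset.sum_add_distrib]
    apply Finset.sum_le_sum
    intro y _
    by_cases h0 : h.eval y = 0
    · simp only [h0, quadraticChar_zero, if_true]; split_ifs <;> norm_num
    · rcases quadraticChar_dichotomy h0 with h1 | h1
      · have := hpow (h.eval y)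
        rw [h1] at this
        simp [h1, ← this, h0]
      · rw [h1]; simp only [h0, if_false]; split_ifs <;> norm_num
  have dn : - ∑ y : L, quadraticChar L (h.eval y) ≤ 2 * (Nm.card : ℤ) - s ^ 2 + N0.card := by
    rw [← hcardL, Finset.card_filter, Finset.card_filter, ← Finset.sum_neg_distrib]
    push_cast
    rw [Finset.mul_sum, ← Finset.sum_sub_distrib, ← Finset.sum_add_distrib]
    apply Finset.sum_le_sum
    intro y _
    by_cases h0 : h.eval y = 0
    · simp only [h0, quadraticChar_zero, if_true]; split_ifs <;> norm_num
    · rcases quadraticChar_dichotomy h0 with h1 | h1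
      · rw [h1]; simp only [h0, if_false]; split_ifs <;> norm_num
      · have := hpow (h.eval y)
        rw [h1] at this
        push_cast at this
        simp [h1, ← this, h0]
  have hqs : q ≤ q * s := Nat.le_mul_of_pos_right _ (by omega)
  rw [abs_le]
  zify at hNp hNm hN0 hqs
  constructor <;> nlinarith

/-- Kloosterman sums -/
noncomputable def kloo {L : Type} [Field L] [Fintype L] [DecidableEq L] (ψ : AddChar L ℂ)
    (a b : L) : ℂ := ∑ x ∈ univ.filter (fun x : L => x ≠ 0), ψ (a * x + b * x⁻¹)

lemma kloo_card {L : Type} [Field L] [Fintype L] [DecidableEq L] (hrc : ringChar L ≠ 2)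
    (a b u : L) (ha : a ≠ 0) (hb : b ≠ 0) :
    (((univ.filter (fun x : L => x ≠ 0)).filter (fun x => a * x + b * x⁻¹ = u)).card : ℤ)
      = quadraticChar L (u ^ 2 - 4 * a * b) + 1 := by
  have h2 : (2 : L) ≠ 0 := Ring.two_ne_zero hrc
  rw [← quadraticChar_card_sqrts hrc]
  norm_cast
  refine Finset.card_bij' (fun x _ => 2 * a * x - u) (fun z _ => (z + u) / (2 * a)) ?_ ?_ ?_ ?_
  · intro x hx
    simp only [mem_filter, mem_univ, true_and] at hx
    obtain ⟨hx, hu⟩ := hx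
    simp only [Set.mem_toFinset, Set.mem_ofPred_eq]
    field_simp at hu
    linear_combination (4 * a) * hu
  · intro z hz
    simp only [Set.mem_toFinset, Set.mem_ofPred_eq] at hz
    simp only [mem_filter, mem_univ, true_and]
    have hne : z + u ≠ 0 := by
      intro h0
      have : 2 * 2 * a * b = 0 := by linear_combination hz - (z - u) * h0
      simp [h2, ha, hb] at this
    refine ⟨div_ne_zero hne (by simp [h2, ha]), ?_⟩
    field_simp
    linear_combination hz
  · intro x _; field_simp; ring
  · intro z _; field_simp; ring

lemma kloo_weak {L : Type} [Field L] [Fintype L] [DecidableEq L] (p : ℕ) [Fact p.Prime] [CharP L p]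
    (hp2 : p ≠ 2)
    (e s q : ℕ) (hs : s = p ^ e) (hso : Odd s) (hcard : Fintype.card L = s ^ 2)
    (hq2 : 2 ≤ q) (hqL : (q : L) = 0)
    (hσ : 2 * (q ^ 2 + q) + 1 < s) (ψ : AddChar L ℂ) (hψ : ψ ≠ 1) (hψq : ∀ y, ψ (y ^ q) = ψ y)
    (a b : L) (ha : a ≠ 0) (hb : b ≠ 0) : ‖kloo ψ a b‖ ≤ 6 * q * s := by
  have hrc : ringChar L ≠ 2 := by rw [ringChar.eq L p]; exact hp2
  have h2 : (2 : L) ≠ 0 := Ring.two_ne_zero hrc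
  have hD : 4 * a * b ≠ 0 := by
    rw [show (4 : L) = 2 * 2 by norm_num]; simp [h2, ha, hb]
  have key : (Fintype.card L : ℂ) * kloo ψ a b =
      ∑ γ : L, ((∑ y : L, quadraticChar L ((y ^ q - y + γ) ^ 2 - 4 * a * b) : ℤ) : ℂ) * ψ γ := by
    have h1 : (Fintype.card L : ℂ) * kloo ψ a b =
        ∑ y : L, ∑ x ∈ univ.filter (fun x : L => x ≠ 0), ψ (a * x + b * x⁻¹ - (y ^ q - y)) := by
      have : ∀ y : L, ∑ x ∈ univ.filter (fun x : L => x ≠ 0), ψ (a * x + b * x⁻¹ - (y ^ q - y))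
          = kloo ψ a b := by
        intro y
        apply Finset.sum_congr rfl
        intro x _
        have h3 : ψ (y ^ q - y) = 1 := by
          rw [AddChar.map_sub_eq_div, hψq, div_self]
          exact norm_ne_zero_iff.1 (by rw [AddChar.norm_apply]; exact one_ne_zero)
        rw [AddChar.map_sub_eq_div, h3, div_one]
      simp [this]
    have h4 : ∑ γ : L, ψ γ * (Fintype.card L : ℂ) = 0 := by
      rw [← Finset.sum_mul, AddChar.sum_eq_zero_of_ne_one hψ, zero_mul]
    rw [h1, ← add_zero (∑ γ : L, _ * ψ γ), ← h4, ← Finset.sum_add_distrib]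
    have h5 : ∀ γ : L, ((∑ y : L, quadraticChar L ((y ^ q - y + γ) ^ 2 - 4 * a * b) : ℤ) : ℂ) * ψ γ
        + ψ γ * (Fintype.card L : ℂ) = ∑ y : L, ∑ x ∈ univ.filter (fun x : L => x ≠ 0),
          if a * x + b * x⁻¹ = y ^ q - y + γ then ψ γ else 0 := by
      intro γ
      have h6 : ∀ y : L, (∑ x ∈ univ.filter (fun x : L => x ≠ 0),
          if a * x + b * x⁻¹ = y ^ q - y + γ then ψ γ else 0) =
          ((quadraticChar L ((y ^ q - y + γ) ^ 2 - 4 * a * b) + 1 : ℤ) : ℂ) * ψ γ := by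
        intro y
        rw [← kloo_card hrc a b _ ha hb, ← Finset.sum_filter, Finset.sum_const, nsmul_eq_mul]
        norm_cast
      simp_rw [h6]
      rw [← Finset.sum_mul]
      push_cast
      rw [Finset.sum_add_distrib]
      simp
      ring
    simp_rw [h5]
    symm
    rw [Finset.sum_comm]
    apply Finset.sum_congr rfl
    intro y _
    rw [Finset.sum_comm]
    apply Finset.sum_congr rfl
    intro x _
    rw [Finset.sum_eq_single (a * x + b * x⁻¹ - (y ^ q - y))]
    · rw [if_pos (by ring)]
    · intro γ _ hγ
      rw [if_neg]
      intro h; apply hγ; rw [h]; ring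
    · simp
  have hQ : (0 : ℝ) < Fintype.card L := by exact_mod_cast Fintype.card_pos
  have hb2 : (Fintype.card L : ℝ) * ‖kloo ψ a b‖ ≤ Fintype.card L * (6 * q * s) := by
    have : (Fintype.card L : ℝ) * ‖kloo ψ a b‖ = ‖(Fintype.card L : ℂ) * kloo ψ a b‖ := by
      rw [norm_mul]; simp
    rw [this, key]
    refine (norm_sum_le _ _).trans ?_
    refine (Finset.sum_le_card_nsmul _ _ (6 * q * s : ℝ) ?_).trans ?_
    · intro γ _
      rw [norm_mul, AddChar.norm_apply, mul_one, Complex.norm_intCast]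
      have := stp_charsum p hp2 e s q hs hso hcard hq2 hqL hσ γ (4 * a * b) hD
      exact_mod_cast this
    · simp
  exact le_of_mul_le_mul_left hb2 hQ

/-- auxiliary double sum -/
noncomputable def klooS {L : Type} [Field L] [Fintype L] [DecidableEq L] (ψ : AddChar L ℂ)
    (a b c : L) : ℂ := ∑ u : L, ∑ v : L,
      if u ^ 2 - c * v ^ 2 = 0 then 0 else ψ (2 * u * (a + b * (u ^ 2 - c * v ^ 2)⁻¹))

lemma klooS_one {L : Type} [Field L] [Fintype L] [DecidableEq L] (h2 : (2 : L) ≠ 0)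
    (ψ : AddChar L ℂ) (a b : L) : klooS ψ a b 1 = kloo ψ a b ^ 2 := by
  have h1 : kloo ψ a b ^ 2 = ∑ z : L × L, if z.1 * z.2 = 0 then 0 else
      ψ ((z.1 + z.2) * (a + b * (z.1 * z.2)⁻¹)) := by
    rw [sq, kloo, Finset.sum_mul_sum, Fintype.sum_prod_type, Finset.sum_filter]
    apply Finset.sum_congr rfl
    intro x _
    by_cases hx : x = 0
    · simp [hx]
    · rw [if_pos hx, Finset.sum_filter]
      apply Finset.sum_congr rfl
      intro y _
      by_cases hy : y = 0
      · simp [hy]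
      · rw [if_pos hy, if_neg (by simp [hx, hy]), ← AddChar.map_add_eq_mul]
        congr 1
        field_simp
        ring
  rw [h1, klooS, ← Fintype.sum_prod_type']
  refine Finset.sum_bij' (fun z _ => (z.1 + z.2, z.1 - z.2))
    (fun z _ => ((z.1 + z.2) / 2, (z.1 - z.2) / 2)) (by simp) (by simp) ?_ ?_ ?_
  · rintro ⟨x, y⟩ _
    ext <;> field_simp <;> ring
  · rintro ⟨x, y⟩ _
    ext <;> field_simp <;> ring
  · rintro ⟨x, y⟩ _
    dsimp only
    rw [show (x + y) * (x - y) = x ^ 2 - 1 * y ^ 2 by ring, show x + y + (x - y) = 2 * x by ring]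

lemma klooS_add {L : Type} [Field L] [Fintype L] [DecidableEq L] (hrc : ringChar L ≠ 2)
    (ψ : AddChar L ℂ) (hψ : ψ ≠ 1) (a b d : L) (ha : a ≠ 0) (hb : b ≠ 0) (hd : ¬ IsSquare d) :
    klooS ψ a b d + klooS ψ a b 1 = 2 * Fintype.card L := by
  have h2 : (2 : L) ≠ 0 := Ring.two_ne_zero hrc
  have hd0 : d ≠ 0 := by rintro rfl; exact hd (IsSquare.zero)
  have hcount : ∀ c : L, c ≠ 0 → ∀ k : L, ((univ.filter (fun v : L => c * v ^ 2 = k)).card : ℤ) =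
      quadraticChar L c * quadraticChar L k + 1 := by
    intro c hc k
    have h3 := quadraticChar_card_sqrts hrc (c * k)
    rw [map_mul] at h3
    rw [← h3]
    norm_cast
    refine Finset.card_bij' (fun v _ => c * v) (fun w _ => w / c) ?_ ?_ ?_ ?_
    · intro v hv
      simp only [mem_filter, mem_univ, true_and] at hv
      simp only [Set.mem_toFinset, Set.mem_ofPred_eq]
      rw [← hv]; ring
    · intro w hw
      simp only [Set.mem_toFinset, Set.mem_ofPred_eq] at hw
      simp only [mem_filter, mem_univ, true_and]
      field_simp
      linear_combination hw
    · intro v _; field_simp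
    · intro v _; field_simp
  have hS : ∀ c : L, c ≠ 0 → klooS ψ a b c = ∑ u : L, ∑ n ∈ univ.filter (fun n : L => n ≠ 0),
      ((quadraticChar L c * quadraticChar L (u ^ 2 - n) + 1 : ℤ) : ℂ) *
        ψ (2 * u * (a + b * n⁻¹)) := by
    intro c hc
    apply Finset.sum_congr rfl
    intro u _
    have h4 : ∀ n : L, ((quadraticChar L c * quadraticChar L (u ^ 2 - n) + 1 : ℤ) : ℂ) *
        ψ (2 * u * (a + b * n⁻¹)) = ∑ v : L, if c * v ^ 2 = u ^ 2 - n then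
          ψ (2 * u * (a + b * n⁻¹)) else 0 := by
      intro n
      rw [← hcount c hc, ← Finset.sum_filter, Finset.sum_const, nsmul_eq_mul]
      norm_cast
    simp_rw [h4]
    rw [Finset.sum_comm]
    apply Finset.sum_congr rfl
    intro v _
    have h5 : ∀ n : L, (c * v ^ 2 = u ^ 2 - n) ↔ n = u ^ 2 - c * v ^ 2 := by
      intro n; constructor <;> intro h <;> linear_combination h
    simp_rw [h5]
    rw [Finset.sum_ite_eq']
    simp only [mem_filter, mem_univ, true_and]
    split_ifs <;> simp_all
  rw [hS d hd0, hS 1 one_ne_zero, ← Finset.sum_add_distrib]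
  simp_rw [← Finset.sum_add_distrib]
  rw [Finset.sum_comm]
  have hprim := AddChar.IsPrimitive.of_ne_one hψ
  have h6 : ∀ n ∈ univ.filter (fun n : L => n ≠ 0), (∑ u : L,
      (((quadraticChar L d * quadraticChar L (u ^ 2 - n) + 1 : ℤ) : ℂ) * ψ (2 * u * (a + b * n⁻¹)) +
      ((quadraticChar L 1 * quadraticChar L (u ^ 2 - n) + 1 : ℤ) : ℂ) * ψ (2 * u * (a + b * n⁻¹))))
      = if n = -b / a then 2 * (Fintype.card L : ℂ) else 0 := by
    intro n hn
    simp only [mem_filter, mem_univ, true_and] at hn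
    have h7 := AddChar.sum_mulShift (2 * (a + b * n⁻¹)) hprim
    have h8 : 2 * (a + b * n⁻¹) = 0 ↔ n = -b / a := by
      rw [mul_eq_zero, or_iff_right h2]
      field_simp
      constructor <;> intro h <;> linear_combination h
    rw [quadraticChar_neg_one_iff_not_isSquare.2 hd]
    have h9 : ∀ u : L, (((-1 * quadraticChar L (u ^ 2 - n) + 1 : ℤ) : ℂ) * ψ (2 * u * (a + b * n⁻¹)) +
      ((quadraticChar L 1 * quadraticChar L (u ^ 2 - n) + 1 : ℤ) : ℂ) * ψ (2 * u * (a + b * n⁻¹)))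
      = 2 * ψ (u * (2 * (a + b * n⁻¹))) := by
      intro u
      rw [map_one, show u * (2 * (a + b * n⁻¹)) = 2 * u * (a + b * n⁻¹) by ring]
      push_cast
      ring
    simp_rw [h9]
    rw [← Finset.mul_sum, h7]
    simp only [h8]
    split_ifs <;> simp
  rw [Finset.sum_congr rfl h6, Finset.sum_ite_eq', if_pos]
  simp [ha, hb]

lemma qa_inv {L : Type} [Field L] (d : L) [Fact (∀ r : L, r ^ 2 ≠ d + 0 * r)] (u v : L)
    (h : u ^ 2 - d * v ^ 2 ≠ 0) : (⟨u, v⟩ : QuadraticAlgebra L d 0)⁻¹ =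
      ⟨u / (u ^ 2 - d * v ^ 2), - v / (u ^ 2 - d * v ^ 2)⟩ := by
  apply inv_eq_of_mul_eq_one_right
  ext
  · simp only [QuadraticAlgebra.re_mul, QuadraticAlgebra.re_one]
    field_simp
    ring
  · simp only [QuadraticAlgebra.im_mul, QuadraticAlgebra.im_one]
    field_simp
    ring

lemma qa_re {L : Type} [Field L] (d : L) (a b u v x y : L) :
    (algebraMap L (QuadraticAlgebra L d 0) a * ⟨u, v⟩ +
      algebraMap L (QuadraticAlgebra L d 0) b * ⟨x, y⟩).re = a * u + b * x := by
  simp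

lemma kloo_ext {L : Type} [Field L] [Fintype L] [DecidableEq L] (p : ℕ) [Fact p.Prime] [CharP L p]
    (hp2 : p ≠ 2) (k : ℕ) (ψ : AddChar L ℂ) (hψ : ψ ≠ 1) (hψq : ∀ y, ψ (y ^ p ^ k) = ψ y)
    (a b : L) (ha : a ≠ 0) (hb : b ≠ 0) :
    ∃ (M : Type) (_ : Field M) (_ : Fintype M) (_ : DecidableEq M) (_ : CharP M p)
      (Ψ : AddChar M ℂ) (a' b' : M), Fintype.card M = Fintype.card L ^ 2 ∧ Ψ ≠ 1 ∧
      (∀ y, Ψ (y ^ p ^ k) = Ψ y) ∧ a' ≠ 0 ∧ b' ≠ 0 ∧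
      kloo Ψ a' b' + kloo ψ a b ^ 2 = 2 * Fintype.card L := by
  have hrc : ringChar L ≠ 2 := by rw [ringChar.eq L p]; exact hp2
  have h2 : (2 : L) ≠ 0 := Ring.two_ne_zero hrc
  obtain ⟨d, hd⟩ := FiniteField.exists_nonsquare hrc
  have : Fact (∀ r : L, r ^ 2 ≠ d + 0 * r) := ⟨fun r hr => hd ⟨r, by rw [← sq, hr]; ring⟩⟩
  let M := QuadraticAlgebra L d 0
  let _ : Fintype M := Fintype.ofEquiv (L × L) (QuadraticAlgebra.equivProd d 0).symm
  let _ : DecidableEq M := Classical.decEq _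
  have hchar : CharP M p := charP_of_injective_algebraMap (algebraMap L M).injective p
  let tr : M →+ L := (QuadraticAlgebra.trace : M →ₗ[L] L).toAddMonoidHom
  have htr : ∀ z : M, tr z = 2 * z.re := by
    intro z
    change QuadraticAlgebra.trace z = _
    rw [QuadraticAlgebra.trace_def]; ring
  let Ψ : AddChar M ℂ := ψ.compAddMonoidHom tr
  have hΨ : ∀ z, Ψ z = ψ (2 * z.re) := by
    intro z; rw [← htr]; rfl
  refine ⟨M, inferInstance, inferInstance, inferInstance, hchar, Ψ, algebraMap L M a, algebraMap L M b,
    ?_, ?_, ?_, ?_, ?_, ?_⟩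
  · rw [Fintype.card_congr (QuadraticAlgebra.equivProd d 0), Fintype.card_prod, sq]
  · obtain ⟨x, hx⟩ := AddChar.ne_one_iff.1 hψ
    rw [AddChar.ne_one_iff]
    refine ⟨⟨x / 2, 0⟩, ?_⟩
    rw [hΨ]
    dsimp only
    rwa [mul_div_cancel₀ _ h2]
  · intro z
    change ψ (tr (z ^ p ^ k)) = ψ (tr z)
    have h3 : tr (z ^ p ^ k) = tr z ^ p ^ k := by
      apply (algebraMap L M).injective
      refine Eq.trans ?_ (map_pow (algebraMap L M) _ _).symm
      change algebraMap L M (QuadraticAlgebra.trace (z ^ p ^ k)) =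
        (algebraMap L M (QuadraticAlgebra.trace z)) ^ p ^ k
      rw [QuadraticAlgebra.algebraMap_trace_eq_add_star, QuadraticAlgebra.algebraMap_trace_eq_add_star,
        add_pow_char_pow, star_pow]
    rw [h3, hψq]
  · simpa using ha
  · simpa using hb
  · rw [← klooS_one h2, ← klooS_add hrc ψ hψ a b d ha hb hd]
    congr 1
    rw [kloo, klooS, ← Fintype.sum_prod_type', Finset.sum_filter]
    refine Fintype.sum_equiv (QuadraticAlgebra.equivProd d 0) _ _ ?_
    rintro ⟨u, v⟩
    have hn : QuadraticAlgebra.norm (⟨u, v⟩ : M) = u ^ 2 - d * v ^ 2 := by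
      rw [QuadraticAlgebra.norm_def]; ring
    change (if (⟨u, v⟩ : M) ≠ 0 then _ else _) = if u ^ 2 - d * v ^ 2 = 0 then 0 else
      ψ (2 * u * (a + b * (u ^ 2 - d * v ^ 2)⁻¹))
    have hiff : u ^ 2 - d * v ^ 2 = 0 ↔ (⟨u, v⟩ : M) = 0 := by
      rw [← hn]; exact QuadraticAlgebra.norm_eq_zero_iff_eq_zero
    by_cases hz : (⟨u, v⟩ : M) = 0
    · rw [if_pos (hiff.2 hz), if_neg (by simpa using hz)]
    · have hn0 : u ^ 2 - d * v ^ 2 ≠ 0 := fun h => hz (hiff.1 h)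
      rw [if_neg hn0, if_pos hz, hΨ]
      rw [qa_inv d u v hn0]
      have hre := qa_re d a b u v (u / (u ^ 2 - d * v ^ 2)) (-v / (u ^ 2 - d * v ^ 2))
      refine Eq.trans (congrArg (fun z => ψ (2 * z)) hre) ?_
      congr 1
      field_simp

/-- uniform Kloosterman bound -/
def KB (p k : ℕ) (c : ℝ) : Prop :=
  ∀ (L : Type) [Field L] [Fintype L] [DecidableEq L] [CharP L p] (ψ : AddChar L ℂ), ψ ≠ 1 →
    (∀ y, ψ (y ^ p ^ k) = ψ y) → ∀ a b : L, a ≠ 0 → b ≠ 0 →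
    ‖kloo ψ a b‖ ^ 2 ≤ c * Fintype.card L

lemma KB_mono {p k : ℕ} {c c' : ℝ} (h : c ≤ c') (hc : KB p k c) : KB p k c' := by
  intro L _ _ _ _ ψ h1 h2 a b ha hb
  refine (hc L ψ h1 h2 a b ha hb).trans ?_
  gcongr

lemma KB_aux {L M : Type} [Field L] [Fintype L] {x y : ℂ} {c : ℝ}
    (h : x + y ^ 2 = 2 * Fintype.card L) (hx : ‖x‖ ≤ c * Fintype.card L) :
    ‖y‖ ^ 2 ≤ (2 + c) * Fintype.card L := by
  have : y ^ 2 = 2 * Fintype.card L - x := by rw [← h]; ring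
  rw [← norm_pow, this]
  refine (norm_sub_le _ _).trans ?_
  rw [norm_mul]
  simp only [Complex.norm_ofNat, Complex.norm_natCast]
  linarith

lemma kloo_triv {L : Type} [Field L] [Fintype L] [DecidableEq L] (ψ : AddChar L ℂ) (a b : L) :
    ‖kloo ψ a b‖ ≤ Fintype.card L := by
  refine (norm_sum_le _ _).trans ?_
  simp only [AddChar.norm_apply, Finset.sum_const, nsmul_eq_mul, mul_one]
  exact_mod_cast Finset.card_le_univ _

lemma KB_start (p k : ℕ) [Fact p.Prime] (hp2 : p ≠ 2) (hk : k ≠ 0) : ∃ c, KB p k c := by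
  set q := p ^ k with hq
  refine ⟨2 + (6 * q + (2 * (q ^ 2 + q) + 1 : ℕ)), ?_⟩
  intro L _ _ _ _ ψ h1 h2 a b ha hb
  obtain ⟨M, _, _, _, _, Ψ, a', b', hM, hΨ, hΨq, ha', hb', hsum⟩ := kloo_ext p hp2 k ψ h1 h2 a b ha hb
  apply KB_aux (M := M) hsum
  obtain ⟨e, hpe, hcardL⟩ := FiniteField.card L p
  have hpp : p.Prime := Fact.out
  have hodd : Odd (Fintype.card L) := by
    rw [hcardL]; exact (hpp.odd_of_ne_two hp2).pow
  have hq2 : 2 ≤ q := hpp.two_le.trans (Nat.le_self_pow hk p)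
  have hqM : (q : M) = 0 := by
    rw [hq]; push_cast; rw [CharP.cast_eq_zero, zero_pow hk]
  by_cases hbig : 2 * (q ^ 2 + q) + 1 < Fintype.card L
  · have := kloo_weak p hp2 e (Fintype.card L) q hcardL hodd hM hq2 hqM hbig Ψ hΨ hΨq a' b' ha' hb'
    refine this.trans ?_
    gcongr
    simp only [le_add_iff_nonneg_right]
    positivity
  · push Not at hbig
    refine (kloo_triv Ψ a' b').trans ?_
    rw [hM, sq]
    push_cast
    gcongr
    have h3 : (Fintype.card L : ℝ) ≤ ((2 * (q ^ 2 + q) + 1 : ℕ) : ℝ) := by exact_mod_cast hbig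
    push_cast at h3
    have : (0 : ℝ) ≤ 6 * q := by positivity
    linarith

lemma KB_step (p k : ℕ) [Fact p.Prime] (hp2 : p ≠ 2) {e : ℝ} (he : 0 ≤ e) (h : KB p k (4 + e)) :
    KB p k (4 + e / 4) := by
  intro L _ _ _ _ ψ h1 h2 a b ha hb
  obtain ⟨M, _, _, _, _, Ψ, a', b', hM, hΨ, hΨq, ha', hb', hsum⟩ := kloo_ext p hp2 k ψ h1 h2 a b ha hb
  rw [show 4 + e / 4 = 2 + (2 + e / 4) by ring]
  apply KB_aux (M := M) hsum
  have h3 := h M Ψ hΨ hΨq a' b' ha' hb'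
  rw [hM] at h3
  push_cast at h3
  apply le_of_sq_le_sq _ (by positivity)
  refine h3.trans ?_
  rw [mul_pow]
  gcongr
  nlinarith

lemma KB_four (p k : ℕ) [Fact p.Prime] (hp2 : p ≠ 2) (hk : k ≠ 0) : KB p k 4 := by
  obtain ⟨c, hc⟩ := KB_start p k hp2 hk
  have h1 : ∀ n : ℕ, KB p k (4 + |c| / 4 ^ n) := by
    intro n
    induction n with
    | zero => exact KB_mono (by have := le_abs_self c; simp; linarith) hc
    | succ n ih =>
      have := KB_step p k hp2 (by positivity) ih
      rwa [div_div, ← pow_succ] at this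
  intro L _ _ _ _ ψ h2 h3 a b ha hb
  have h4 : ∀ n : ℕ, ‖kloo ψ a b‖ ^ 2 ≤ (4 + |c| * (1 / 4) ^ n) * Fintype.card L := by
    intro n
    have := h1 n L ψ h2 h3 a b ha hb
    rwa [div_eq_mul_one_div, ← one_div_pow] at this
  have h5 : Filter.Tendsto (fun n : ℕ => (4 + |c| * (1 / 4 : ℝ) ^ n) * Fintype.card L) Filter.atTop
      (nhds ((4 + |c| * 0) * Fintype.card L)) := by
    apply Filter.Tendsto.mul_const
    apply Filter.Tendsto.const_add
    apply Filter.Tendsto.const_mul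
    exact tendsto_pow_atTop_nhds_zero_of_lt_one (by norm_num) (by norm_num)
  have := ge_of_tendsto' h5 h4
  simpa using this

lemma kloo_weil {F : Type} [Field F] [Fintype F] [DecidableEq F] (hq : Odd (Fintype.card F))
    (ψ : AddChar F ℂ) (hψ : ψ ≠ 1) (a b : F) (ha : a ≠ 0) :
    ‖kloo ψ a b‖ ≤ 2 * Real.sqrt (Fintype.card F) := by
  have hQ : (1 : ℝ) ≤ Fintype.card F := by exact_mod_cast Fintype.card_pos
  have hs1 : 1 ≤ Real.sqrt (Fintype.card F) := Real.one_le_sqrt.2 hQ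
  by_cases hb : b = 0
  · have h1 : kloo ψ a b = -1 := by
      have h2 := AddChar.sum_mulShift a (AddChar.IsPrimitive.of_ne_one hψ)
      rw [if_neg ha, ← Finset.sum_filter_add_sum_filter_not univ (fun x : F => x ≠ 0)] at h2
      have h3 : univ.filter (fun x : F => ¬ x ≠ 0) = {0} := by ext; simp
      rw [h3] at h2
      simp only [Finset.sum_singleton, zero_mul, AddChar.map_zero_eq_one] at h2
      have h4 : kloo ψ a b = ∑ x ∈ univ.filter (fun x : F => x ≠ 0), ψ (x * a) := by
        rw [kloo, hb]
        apply Finset.sum_congr rfl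
        intro x _
        congr 1; ring
      rw [h4]
      push_cast at h2
      linear_combination h2
    rw [h1]; simp; linarith
  · obtain ⟨p, hp⟩ := CharP.exists F
    obtain ⟨n, hpp, hcard⟩ := FiniteField.card F p
    have : Fact p.Prime := ⟨hpp⟩
    have hp2 : p ≠ 2 := by
      rintro rfl
      rw [hcard] at hq
      have : Even (2 ^ (n : ℕ)) := (even_two).pow_of_ne_zero n.ne_zero
      exact (Nat.not_even_iff_odd.2 hq) this
    have h := KB_four p n hp2 n.ne_zero F ψ hψ (by
      intro y; rw [← hcard, FiniteField.pow_card]) a b ha hb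
    apply le_of_sq_le_sq _ (by positivity)
    rw [mul_pow, Real.sq_sqrt (by positivity)]
    linarith

lemma gauss_sq_sum {F : Type} [Field F] [Fintype F] [DecidableEq F] (hrc : ringChar F ≠ 2)
    (ψ : AddChar F ℂ) (hψ : ψ ≠ 1) :
    (∑ v : F, ψ (v ^ 2)) ^ 2 = ((quadraticChar F (-1) : ℤ) : ℂ) * Fintype.card F := by
  have hprim := AddChar.IsPrimitive.of_ne_one hψ
  have h1 : ∑ v : F, ψ (v ^ 2) =
      gaussSum ((quadraticChar F).ringHomComp (Int.castRingHom ℂ)) ψ := by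
    have h2 : ∀ n : F, (((quadraticChar F n + 1 : ℤ)) : ℂ) * ψ n =
        ∑ v : F, if v ^ 2 = n then ψ n else 0 := by
      intro n
      rw [← quadraticChar_card_sqrts hrc n, ← Finset.sum_filter, Finset.sum_const, nsmul_eq_mul]
      congr 1
      norm_cast
      congr 1
      ext v
      simp
    have h3 : ∑ n : F, (((quadraticChar F n + 1 : ℤ)) : ℂ) * ψ n = ∑ v : F, ψ (v ^ 2) := by
      simp_rw [h2]
      rw [Finset.sum_comm]
      apply Finset.sum_congr rfl
      intro v _
      rw [Finset.sum_ite_eq]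
      simp
    rw [← h3, gaussSum]
    push_cast
    simp_rw [add_mul, one_mul]
    rw [Finset.sum_add_distrib, AddChar.sum_eq_zero_of_ne_one hψ, add_zero]
    rfl
  rw [h1, gaussSum_sq _ _ hprim]
  · rfl
  · rw [MulChar.ringHomComp_ne_one_iff (RingHom.injective_int _)]
    exact quadraticChar_ne_one hrc
  · exact (quadraticChar_isQuadratic F).comp _

/-- dot product on the plane -/
def dot2 {F : Type} [Field F] (x y : F × F) : F := x.1 * y.1 + x.2 * y.2

lemma gauss_two_dim {F : Type} [Field F] [Fintype F] [DecidableEq F] (hrc : ringChar F ≠ 2)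
    (ψ : AddChar F ℂ) (hψ : ψ ≠ 1) (r : F) (hr : r ≠ 0) (d : F × F) :
    ∑ ξ : F × F, ψ (-nrm ξ / 4 * r⁻¹ + dot2 ξ d) =
      ψ (r * nrm d) * (((quadraticChar F (-1) : ℤ) : ℂ) * Fintype.card F) := by
  have h2 : (2 : F) ≠ 0 := Ring.two_ne_zero hrc
  have h4 : (4 : F) ≠ 0 := by
    rw [show (4 : F) = 2 * 2 by norm_num]; exact mul_ne_zero h2 h2
  have hc : -(4 * r)⁻¹ ≠ 0 := neg_ne_zero.2 (inv_ne_zero (mul_ne_zero h4 hr))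
  have hψ2 : ψ.mulShift (-(4 * r)⁻¹) ≠ 1 := AddChar.IsPrimitive.of_ne_one hψ hc
  rw [← gauss_sq_sum hrc _ hψ2, sq, Finset.sum_mul_sum, ← Fintype.sum_prod_type', Finset.mul_sum]
  refine Fintype.sum_equiv (Equiv.subRight (2 * r * d.1, 2 * r * d.2)) _ _ ?_
  rintro ⟨u, v⟩
  simp only [Equiv.subRight_apply, Prod.mk_sub_mk, AddChar.mulShift_apply,
    ← AddChar.map_add_eq_mul]
  congr 1
  simp only [nrm, dot2]
  rw [show (4 : F) = 2 * 2 by norm_num]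
  field_simp
  ring

lemma circle_fourier {F : Type} [Field F] [Fintype F] [DecidableEq F] (hrc : ringChar F ≠ 2)
    (ψ : AddChar F ℂ) (hψ : ψ ≠ 1) (t : F) (d : F × F) :
    ∑ ξ : F × F, kloo ψ (-t) (-nrm ξ / 4) * ψ (dot2 ξ d) =
      (((quadraticChar F (-1) : ℤ) : ℂ) * Fintype.card F) *
        ((if nrm d = t then (Fintype.card F : ℂ) else 0) - 1) := by
  have h1 : ∀ ξ : F × F, kloo ψ (-t) (-nrm ξ / 4) * ψ (dot2 ξ d) =
      ∑ r ∈ univ.filter (fun r : F => r ≠ 0),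
        ψ (-t * r) * ψ (-nrm ξ / 4 * r⁻¹ + dot2 ξ d) := by
    intro ξ
    rw [kloo, Finset.sum_mul]
    apply Finset.sum_congr rfl
    intro r _
    rw [← AddChar.map_add_eq_mul, ← AddChar.map_add_eq_mul, add_assoc]
  simp_rw [h1]
  rw [Finset.sum_comm]
  have h2 : ∀ r ∈ univ.filter (fun r : F => r ≠ 0),
      ∑ ξ : F × F, ψ (-t * r) * ψ (-nrm ξ / 4 * r⁻¹ + dot2 ξ d) =
      (((quadraticChar F (-1) : ℤ) : ℂ) * Fintype.card F) * ψ (r * (nrm d - t)) := by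
    intro r hr
    simp only [mem_filter, mem_univ, true_and] at hr
    rw [← Finset.mul_sum, gauss_two_dim hrc ψ hψ r hr d, ← mul_assoc, ← AddChar.map_add_eq_mul,
      mul_comm, show -t * r + r * nrm d = r * (nrm d - t) by ring]
  rw [Finset.sum_congr rfl h2, ← Finset.mul_sum]
  congr 1
  have h3 := AddChar.sum_mulShift (nrm d - t) (AddChar.IsPrimitive.of_ne_one hψ)
  rw [Finset.filter_ne', ← Finset.add_sum_erase _ _ (mem_univ (0 : F))] at *
  simp only [zero_mul, AddChar.map_zero_eq_one, sub_eq_zero] at h3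
  rw [eq_sub_iff_add_eq, add_comm, h3]
  split_ifs <;> simp

lemma plancherel2 {F : Type} [Field F] [Fintype F] [DecidableEq F]
    (ψ : AddChar F ℂ) (hψ : ψ ≠ 1) (S : Finset (F × F)) :
    ∑ ξ : F × F, ‖∑ x ∈ S, ψ (dot2 ξ x)‖ ^ 2 = (Fintype.card F : ℝ) ^ 2 * S.card := by
  have hprim := AddChar.IsPrimitive.of_ne_one hψ
  have h1 : ∀ ξ : F × F, ((‖∑ x ∈ S, ψ (dot2 ξ x)‖ ^ 2 : ℝ) : ℂ) =
      ∑ x ∈ S, ∑ y ∈ S, ψ (ξ.1 * (x.1 - y.1)) * ψ (ξ.2 * (x.2 - y.2)) := by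
    intro ξ
    push_cast
    rw [← Complex.mul_conj', map_sum, Finset.sum_mul_sum]
    apply Finset.sum_congr rfl
    intro x _
    apply Finset.sum_congr rfl
    intro y _
    rw [← AddChar.map_neg_eq_conj, ← AddChar.map_add_eq_mul, ← AddChar.map_add_eq_mul]
    congr 1
    simp only [dot2]
    ring
  have h2 : ∀ x y : F × F, ∑ ξ : F × F, ψ (ξ.1 * (x.1 - y.1)) * ψ (ξ.2 * (x.2 - y.2)) =
      if x = y then (Fintype.card F : ℂ) ^ 2 else 0 := by
    intro x y
    rw [Fintype.sum_prod_type]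
    dsimp only
    rw [← Finset.sum_mul_sum, AddChar.sum_mulShift _ hprim,
      AddChar.sum_mulShift _ hprim]
    simp only [sub_eq_zero, Prod.ext_iff]
    split_ifs <;> simp_all [sq]
  have h3 : ((∑ ξ : F × F, ‖∑ x ∈ S, ψ (dot2 ξ x)‖ ^ 2 : ℝ) : ℂ) =
      (((Fintype.card F : ℝ) ^ 2 * S.card : ℝ) : ℂ) := by
    rw [Complex.ofReal_sum, Finset.sum_congr rfl (fun ξ _ => h1 ξ), Finset.sum_comm]
    have h4 : ∀ x ∈ S, ∑ ξ : F × F, ∑ y ∈ S, ψ (ξ.1 * (x.1 - y.1)) * ψ (ξ.2 * (x.2 - y.2)) =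
        (Fintype.card F : ℂ) ^ 2 := by
      intro x hx
      rw [Finset.sum_comm, Finset.sum_congr rfl (fun y _ => h2 x y), Finset.sum_ite_eq, if_pos hx]
    rw [Finset.sum_congr rfl h4, Finset.sum_const, nsmul_eq_mul]
    push_cast
    ring
  exact_mod_cast h3

/-- the slice of `A` of points whose translate by `-a` lies in `B` -/
def slice2 {F : Type} [Field F] [DecidableEq F] (A B : Finset (F × F)) (a : F × F) :
    Finset (F × F) := A.filter (fun x => x - a ∈ B)

lemma slice2_card {F : Type} [Field F] [Fintype F] [DecidableEq F] (A B : Finset (F × F)) :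
    ∑ a : F × F, (slice2 A B a).card = A.card * B.card := by
  rw [← Finset.card_sigma, ← Finset.card_product]
  refine Finset.card_bij' (fun z _ => (z.2, z.2 - z.1)) (fun p _ => ⟨p.1 - p.2, p.1⟩) ?_ ?_ ?_ ?_
  · rintro ⟨a, x⟩ h; simpa [slice2] using h
  · rintro ⟨a, x⟩ h; simpa [slice2] using h
  · rintro ⟨a, x⟩ h; simp
  · rintro ⟨a, x⟩ h; simp

lemma par_split {F : Type} [Field F] [Fintype F] [DecidableEq F] (E1 E2 E3 E4 : Finset (F × F))
    (g : F × F → F × F → ℂ) :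
    ∑ p ∈ ((E1 ×ˢ E2) ×ˢ E3 ×ˢ E4).filter (fun p => p.1.1 - p.1.2 = p.2.1 - p.2.2),
      g p.1.1 p.1.2 = ∑ a : F × F, ∑ x ∈ slice2 E1 E3 a, ∑ y ∈ slice2 E2 E4 a, g x y := by
  simp_rw [← Finset.sum_product']
  rw [Finset.sum_sigma']
  refine Finset.sum_bij' (fun p _ => ⟨p.1.1 - p.2.1, (p.1.1, p.1.2)⟩)
    (fun z _ => ((z.2.1, z.2.2), (z.2.1 - z.1, z.2.2 - z.1))) ?_ ?_ ?_ ?_ ?_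
  · rintro ⟨⟨x, y⟩, z, w⟩ h
    simp only [mem_filter, mem_product] at h
    obtain ⟨⟨⟨hx, hy⟩, hz, hw⟩, he⟩ := h
    have : y - (x - z) = w := by
      rw [show y - (x - z) = z - (x - y) by abel, he]; abel
    simp [slice2, hx, hy, hz, this, hw]
  · rintro ⟨a, x, y⟩ h
    simp only [slice2, mem_sigma, mem_univ, true_and, mem_product, mem_filter] at h
    simp [h]
  · rintro ⟨⟨x, y⟩, z, w⟩ h
    simp only [mem_filter, mem_product] at h
    obtain ⟨-, he⟩ := h
    have : y - (x - z) = w := by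
      rw [show y - (x - z) = z - (x - y) by abel, he]; abel
    simp [this]
  · rintro ⟨a, x, y⟩ h
    simp
  · rintro ⟨⟨x, y⟩, z, w⟩ h
    rfl

lemma par_l1 {F : Type} [Field F] [Fintype F] [DecidableEq F]
    (ψ : AddChar F ℂ) (hψ : ψ ≠ 1) (E1 E2 E3 E4 : Finset (F × F)) :
    ∑ ξ : F × F, ‖∑ p ∈ ((E1 ×ˢ E2) ×ˢ E3 ×ˢ E4).filter
      (fun p => p.1.1 - p.1.2 = p.2.1 - p.2.2), ψ (dot2 ξ (p.1.1 - p.1.2))‖ ≤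
      (Fintype.card F : ℝ) ^ 2 *
        Real.sqrt ((E1.card : ℝ) * E2.card * E3.card * E4.card) := by
  have h1 : ∀ ξ : F × F, ‖∑ p ∈ ((E1 ×ˢ E2) ×ˢ E3 ×ˢ E4).filter
      (fun p => p.1.1 - p.1.2 = p.2.1 - p.2.2), ψ (dot2 ξ (p.1.1 - p.1.2))‖ ≤
      ∑ a : F × F, ‖∑ x ∈ slice2 E1 E3 a, ψ (dot2 ξ x)‖ * ‖∑ y ∈ slice2 E2 E4 a, ψ (dot2 ξ y)‖ := by
    intro ξ
    rw [par_split E1 E2 E3 E4 (fun x y => ψ (dot2 ξ (x - y)))]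
    refine (norm_sum_le _ _).trans (Finset.sum_le_sum fun a _ => ?_)
    rw [← RCLike.norm_conj (K := ℂ) (∑ y ∈ slice2 E2 E4 a, ψ (dot2 ξ y)), ← norm_mul, map_sum,
      Finset.sum_mul_sum]
    apply le_of_eq
    congr 1
    apply Finset.sum_congr rfl
    intro x _
    apply Finset.sum_congr rfl
    intro y _
    rw [← AddChar.map_neg_eq_conj, ← AddChar.map_add_eq_mul]
    congr 1
    simp only [dot2, Prod.fst_sub, Prod.snd_sub]
    ring
  refine (Finset.sum_le_sum fun ξ _ => h1 ξ).trans ?_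
  rw [← Fintype.sum_prod_type']
  refine (Real.sum_mul_le_sqrt_mul_sqrt _ _ _).trans ?_
  have h2 : ∀ A B : Finset (F × F), ∑ z : (F × F) × (F × F),
      ‖∑ x ∈ slice2 A B z.2, ψ (dot2 z.1 x)‖ ^ 2 =
      (Fintype.card F : ℝ) ^ 2 * (A.card * B.card) := by
    intro A B
    rw [Fintype.sum_prod_type, Finset.sum_comm]
    simp_rw [plancherel2 ψ hψ]
    rw [← Finset.mul_sum]
    congr 1
    exact_mod_cast slice2_card A B
  rw [h2, h2, ← Real.sqrt_mul (by positivity)]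
  apply le_of_eq
  rw [show (Fintype.card F : ℝ) ^ 2 * (E1.card * E3.card) *
    ((Fintype.card F : ℝ) ^ 2 * (E2.card * E4.card)) = ((Fintype.card F : ℝ) ^ 2) ^ 2 *
    ((E1.card : ℝ) * E2.card * E3.card * E4.card) by ring, Real.sqrt_mul (by positivity),
    Real.sqrt_sq (by positivity)]

theorem parT_close_to_parAll_div_q
    {F : Type} [Field F] [Fintype F] [DecidableEq F]
    (hq : Odd (Fintype.card F)) (t : F) (ht : t ≠ 0)
    (E1 E2 E3 E4 : Finset (F × F)) :
    |(parT t E1 E2 E3 E4 : ℝ) -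
        (parAll E1 E2 E3 E4 : ℝ) / (Fintype.card F : ℝ)| ≤
      2 * Real.sqrt (Fintype.card F) *
        Real.sqrt ((E1.card : ℝ) * E2.card * E3.card * E4.card) := by
  have hrc : ringChar F ≠ 2 := by
    intro h
    have := FiniteField.even_card_of_char_two h
    rw [Nat.odd_iff] at hq
    omega
  obtain ⟨ψ, hψ1⟩ := AddChar.exists_apply_ne_zero.2 (one_ne_zero (α := F))
  have hψ : ψ ≠ 1 := by
    rintro rfl
    exact hψ1 rfl
  have hqpos : (0 : ℝ) < Fintype.card F := by exact_mod_cast Fintype.card_pos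
  have hqc : (Fintype.card F : ℂ) ≠ 0 := by exact_mod_cast hqpos.ne'
  set Q := ((E1 ×ˢ E2) ×ˢ E3 ×ˢ E4).filter (fun p => p.1.1 - p.1.2 = p.2.1 - p.2.2) with hQ
  have hT : (parT t E1 E2 E3 E4 : ℂ) = ∑ p ∈ Q, if nrm (p.1.1 - p.1.2) = t then (1 : ℂ) else 0 := by
    rw [← Finset.sum_filter, hQ, Finset.filter_filter, Finset.sum_const, nsmul_eq_mul, mul_one]
    rfl
  have hA : (parAll E1 E2 E3 E4 : ℂ) = ∑ p ∈ Q, (1 : ℂ) := by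
    rw [Finset.sum_const, nsmul_eq_mul, mul_one]
    rfl
  have hkey : (((quadraticChar F (-1) : ℤ) : ℂ) * Fintype.card F) * (Fintype.card F *
      ((parT t E1 E2 E3 E4 : ℂ) - (parAll E1 E2 E3 E4 : ℂ) / (Fintype.card F : ℂ))) =
      ∑ ξ : F × F, kloo ψ (-t) (-nrm ξ / 4) * ∑ p ∈ Q, ψ (dot2 ξ (p.1.1 - p.1.2)) := by
    simp_rw [Finset.mul_sum Q]
    rw [Finset.sum_comm, Finset.sum_congr rfl
      (fun p _ => circle_fourier hrc ψ hψ t (p.1.1 - p.1.2)), ← Finset.mul_sum]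
    congr 1
    rw [mul_sub, mul_div_cancel₀ _ hqc, hT, hA, Finset.sum_sub_distrib, Finset.mul_sum]
    congr 1
    apply Finset.sum_congr rfl
    intro p _
    split_ifs <;> simp
  have heps : ‖((quadraticChar F (-1) : ℤ) : ℂ)‖ = 1 := by
    rcases quadraticChar_dichotomy (F := F) (a := -1) (by simp) with h | h <;> rw [h] <;> simp
  have hn := congrArg norm hkey
  have hcast : ‖((parT t E1 E2 E3 E4 : ℂ) - (parAll E1 E2 E3 E4 : ℂ) / (Fintype.card F : ℂ))‖ =
      |(parT t E1 E2 E3 E4 : ℝ) - (parAll E1 E2 E3 E4 : ℝ) / (Fintype.card F : ℝ)| := by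
    rw [← Real.norm_eq_abs, ← Complex.norm_real]
    push_cast
    rfl
  rw [norm_mul, norm_mul, norm_mul, heps, hcast, Complex.norm_natCast, one_mul] at hn
  have hb : ‖∑ ξ : F × F, kloo ψ (-t) (-nrm ξ / 4) * ∑ p ∈ Q, ψ (dot2 ξ (p.1.1 - p.1.2))‖ ≤
      (2 * Real.sqrt (Fintype.card F)) * ((Fintype.card F : ℝ) ^ 2 *
        Real.sqrt ((E1.card : ℝ) * E2.card * E3.card * E4.card)) := by
    refine (norm_sum_le _ _).trans ?_
    refine le_trans ?_ (mul_le_mul_of_nonneg_left (par_l1 ψ hψ E1 E2 E3 E4) (by positivity))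
    rw [Finset.mul_sum]
    apply Finset.sum_le_sum
    intro ξ _
    rw [norm_mul]
    exact mul_le_mul_of_nonneg_right
      (kloo_weil hq ψ hψ (-t) _ (neg_ne_zero.2 ht)) (norm_nonneg _)
  rw [← hn] at hb
  have hq2 : (0 : ℝ) < (Fintype.card F : ℝ) ^ 2 := by positivity
  refine le_of_mul_le_mul_left ?_ hq2
  calc _ = _ := by ring
    _ ≤ _ := hb
    _ = _ := by ring
end
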